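/- arXiv:1505.03023 — 14 statements merged into one kernel-verified Lean document; each statement's English description precedes it below -/
import Mathlib

section
/- Let (X, φ) be a convex geometry whose complete lattice L = Cl(X, φ) of closed sets (ordered by inclusion) is weakly atomic. Then L is spatial: every closed set is the supremum in L of the completely join-irreducible closed sets contained in it. -/
/-- In the lattice of closed sets of a monotone, extensive operator, intersections are closed. -/
theorem closed_inter {X : Type*} {φ : Set X → Set X} (hext : ∀ Y : Set X, Y ⊆ φ Y)
    (hmono : ∀ Y Z : Set X, Y ⊆ Z → φ Y ⊆ φ Z) {A B : Set X} (hA : φ A = A) (hB : φ B = B) :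
    φ (A ∩ B) = A ∩ B :=
  Set.Subset.antisymm
    (Set.subset_inter ((hmono _ _ Set.inter_subset_left).trans hA.subset)
      ((hmono _ _ Set.inter_subset_right).trans hB.subset))
    (hext _)

/-- A covering pair of closed sets in a convex geometry differs in exactly one point. -/
theorem eq_of_mem_diff_of_covBy {X : Type*} {φ : Set X → Set X} (hext : ∀ Y : Set X, Y ⊆ φ Y)
    (hmono : ∀ Y Z : Set X, Y ⊆ Z → φ Y ⊆ φ Z) (hidem : ∀ Y : Set X, φ (φ Y) = φ Y)
    (hae : ∀ A : Set X, φ A = A → ∀ x y : X, x ≠ y → x ∉ A →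
      x ∈ φ (A ∪ {y}) → y ∉ φ (A ∪ {x}))
    {u v : {A : Set X // φ A = A}} (huv : u ⋖ v) {x y : X}
    (hxv : x ∈ v.1) (hxu : x ∉ u.1) (hyv : y ∈ v.1) (hyu : y ∉ u.1) : x = y := by
  have generate : ∀ z ∈ v.1, z ∉ u.1 → φ (u.1 ∪ {z}) = v.1 := by
    intro z hzv hzu
    have hz : z ∈ φ (u.1 ∪ {z}) := hext _ (Or.inr rfl)
    have hlt : u < ⟨φ (u.1 ∪ {z}), hidem _⟩ :=
      lt_of_le_not_ge (fun w hw => hext _ (Or.inl hw)) (fun h => hzu (h hz))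
    have hle : (⟨φ (u.1 ∪ {z}), hidem _⟩ : {A : Set X // φ A = A}) ≤ v :=
      (hmono _ _ (Set.union_subset huv.le (Set.singleton_subset_iff.2 hzv))).trans v.2.subset
    exact congrArg Subtype.val (hle.eq_of_not_lt (huv.2 hlt))
  by_contra hne
  exact hae u.1 u.2 x y hne hxu (by rwa [generate y hyv hyu]) (by rwa [generate x hxv hxu])

/-- A weakly atomic convexity lattice is spatial. -/
theorem stmt_0 {X : Type*} (φ : Set X → Set X)
    (hext : ∀ Y : Set X, Y ⊆ φ Y)
    (hmono : ∀ Y Z : Set X, Y ⊆ Z → φ Y ⊆ φ Z)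
    (hidem : ∀ Y : Set X, φ (φ Y) = φ Y)
    (hempty : φ ∅ = ∅)
    (hae : ∀ A : Set X, φ A = A → ∀ x y : X, x ≠ y → x ∉ A →
      x ∈ φ (A ∪ {y}) → y ∉ φ (A ∪ {x}))
    (hwa : ∀ a b : {A : Set X // φ A = A}, a < b →
      ∃ u v : {A : Set X // φ A = A}, a ≤ u ∧ u ⋖ v ∧ v ≤ b) :
    ∀ a : {A : Set X // φ A = A},
      IsLUB {j : {A : Set X // φ A = A} |
        ¬ IsLUB {x : {A : Set X // φ A = A} | x < j} j ∧ j ≤ a} a := by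
  intro a
  refine ⟨fun j hj => hj.2, fun c hc => ?_⟩
  by_contra hac
  have hlt : (⟨a.1 ∩ c.1, closed_inter hext hmono a.2 c.2⟩ : {A : Set X // φ A = A}) < a :=
    lt_of_le_not_ge (fun w hw => hw.1) (fun h => hac (fun w hw => (h hw).2))
  obtain ⟨u, v, hu, huv, hva⟩ := hwa _ _ hlt
  obtain ⟨x, hxv, hxu⟩ := Set.not_subset.1 (show ¬ v.1 ⊆ u.1 from huv.lt.not_ge)
  have hx : x ∈ φ {x} := hext _ rfl
  have hjv : φ {x} ⊆ v.1 := (hmono _ _ (Set.singleton_subset_iff.2 hxv)).trans v.2.subset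
  let j : {A : Set X // φ A = A} := ⟨φ {x}, hidem _⟩
  have hj : ¬ IsLUB {y : {A : Set X // φ A = A} | y < j} j := by
    intro h
    have hub : u ∈ upperBounds {y : {A : Set X // φ A = A} | y < j} := by
      intro y (hy : y < j) w hw
      by_contra hwu
      have hxw : x = w := eq_of_mem_diff_of_covBy hext hmono hidem hae huv hxv hxu
        (hjv ((show y.1 ⊆ φ {x} from hy.le) hw)) hwu
      subst hxw
      exact hy.not_ge ((hmono _ _ (Set.singleton_subset_iff.2 hw)).trans y.2.subset)
    exact hxu (h.2 hub hx)
  exact hxu (hu ⟨hva hxv, hc ⟨hj, hjv.trans hva⟩ hx⟩)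
end

section
/- Let (X, φ) be a convex geometry and L = Cl(X, φ) its complete lattice of closed sets ordered by inclusion. If L is algebraic (every element is the supremum of compact elements below it), or if L is order-scattered, then L is spatial. -/
/-- In a poset in which every set has a supremum, a compact element `k` below `a` but not below
`b ≤ a` produces a covering pair between `b` and `a`. -/
theorem exists_covBy_of_compact {L : Type*} [PartialOrder L] (hsup : ∀ S : Set L, ∃ s, IsLUB S s)
    {a b k : L}
    (hk : ∀ (S : Set L) (s : L), IsLUB S s → k ≤ s →
      ∃ F : Finset L, ↑F ⊆ S ∧ ∃ t : L, IsLUB (↑F : Set L) t ∧ k ≤ t)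
    (hka : k ≤ a) (hkb : ¬ k ≤ b) (hba : b ≤ a) :
    ∃ m n, b ≤ m ∧ m ⋖ n ∧ n ≤ a := by
  classical
  obtain ⟨m, hbm, ⟨hma, hkm⟩, hmax⟩ := zorn_le_nonempty₀ {x : L | x ≤ a ∧ ¬ k ≤ x} (by
    intro c hc hchain y hy
    obtain ⟨s, hs⟩ := hsup c
    refine ⟨s, ⟨hs.2 fun x hx => (hc hx).1, fun hks => ?_⟩, fun z hz => hs.1 hz⟩
    obtain ⟨F, hFc, t, ht, hkt⟩ := hk c s hs hks
    have hFm : ∃ m ∈ c, ∀ x ∈ F, x ≤ m := by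
      clear hkt ht
      induction F using Finset.induction_on with
      | empty => exact ⟨y, hy, by simp⟩
      | insert x F _ ih =>
        rw [Finset.coe_insert, Set.insert_subset_iff] at hFc
        obtain ⟨m, hm, hFm⟩ := ih hFc.2
        obtain ⟨p, hp, hxp, hmp⟩ := hchain.directedOn x hFc.1 m hm
        exact ⟨p, hp, Finset.forall_mem_insert _ _ _ |>.2
          ⟨hxp, fun z hz => (hFm z hz).trans hmp⟩⟩
    obtain ⟨m, hm, hFm⟩ := hFm
    exact (hc hm).2 (hkt.trans (ht.2 hFm))) b ⟨hba, hkb⟩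
  obtain ⟨n, hn⟩ := hsup {m, k}
  have hmn : m ≤ n := hn.1 (by simp)
  have hkn : k ≤ n := hn.1 (by simp)
  have hna : n ≤ a := hn.2 (by simp [upperBounds, hma, hka])
  refine ⟨m, n, hbm, ⟨hmn.lt_of_ne fun h => hkm (h ▸ hkn), fun z hmz hzn => ?_⟩, hna⟩
  by_cases hkz : k ≤ z
  · exact hzn.not_ge (hn.2 (by simp [upperBounds, hmz.le, hkz]))
  · exact hmz.not_ge (hmax ⟨hzn.le.trans hna, hkz⟩ hmz.le)

/-- A nontrivial interval without covering pairs contains a copy of the rationals. -/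
theorem nonempty_rat_orderEmbedding_of_not_covBy {L : Type*} [PartialOrder L] {a b : L}
    (hba : b < a) (h : ∀ m n, b ≤ m → n ≤ a → ¬ m ⋖ n) : Nonempty (ℚ ↪o L) := by
  classical
  have : Fact (b ≤ a) := ⟨hba.le⟩
  obtain ⟨s, -⟩ := (IsChain.empty (r := (· ≤ ·)) (α := Set.Icc b a)).exists_subset_flag
  have : Nontrivial s :=
    ⟨⟨⊥, s.bot_mem⟩, ⟨⊤, s.top_mem⟩, fun h => hba.ne (congrArg (fun x : s => (x.1 : L)) h)⟩
  have : DenselyOrdered s := denselyOrdered_iff_forall_not_covBy.2 fun x y hxy => by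
    have hxy' : (x : Set.Icc b a) ⋖ y := Flag.coe_covBy_coe.2 hxy
    refine h x y x.1.2.1 y.1.2.2 ⟨hxy'.1, fun z hxz hzy => ?_⟩
    exact hxy'.2 (c := ⟨z, x.1.2.1.trans hxz.le, hzy.le.trans y.1.2.2⟩) hxz hzy
  obtain ⟨e⟩ := Order.embedding_from_countable_to_dense ℚ s
  exact ⟨(e.trans (OrderEmbedding.subtype _)).trans (OrderEmbedding.subtype _)⟩

/-- In a convex geometry, a covering pair `m ⋖ n` of closed sets yields a point of `n \ m` whose
closure is completely join-irreducible. -/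
theorem exists_joinIrreducible_of_covBy {X : Type*} (φ : Set X → Set X)
    (hext : ∀ Y : Set X, Y ⊆ φ Y)
    (hmono : ∀ Y Z : Set X, Y ⊆ Z → φ Y ⊆ φ Z)
    (hidem : ∀ Y : Set X, φ (φ Y) = φ Y)
    (hae : ∀ A : Set X, φ A = A → ∀ x y : X, x ≠ y → x ∉ A →
      x ∈ φ (A ∪ {y}) → y ∉ φ (A ∪ {x}))
    {m n : {A : Set X // φ A = A}} (hmn : m ⋖ n) :
    ∃ j : {A : Set X // φ A = A}, ¬ IsLUB {x | x < j} j ∧ j ≤ n ∧ ¬ j ≤ m := by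
  have closure_insert : ∀ y ∈ n.1, y ∉ m.1 → φ (m.1 ∪ {y}) = n.1 := by
    intro y hyn hym
    let z : {A : Set X // φ A = A} := ⟨φ (m.1 ∪ {y}), hidem _⟩
    have hy : y ∈ z.1 := hext _ (Or.inr rfl)
    have hmz : m ≤ z := fun x hx => hext _ (Or.inl hx)
    have hzn : z ≤ n := by
      change φ (m.1 ∪ {y}) ⊆ n.1
      rw [← n.2]
      exact hmono _ _ (Set.union_subset hmn.le (by simpa using hyn))
    have hmz' : m < z := hmz.lt_of_ne fun h => hym (h ▸ hy)
    exact congrArg Subtype.val (hzn.eq_of_not_lt (hmn.2 hmz'))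
  obtain ⟨f, hfn, hfm⟩ := Set.not_subset.1 (show ¬ n.1 ⊆ m.1 from hmn.1.not_ge)
  have unique : ∀ y ∈ n.1, y ∉ m.1 → y = f := by
    intro y hyn hym
    by_contra hne
    refine hae m.1 m.2 f y (Ne.symm hne) hfm ?_ ?_
    · rwa [closure_insert y hyn hym]
    · rwa [closure_insert f hfn hfm]
  have hfj : f ∈ φ {f} := hext _ rfl
  have hjn : φ {f} ⊆ n.1 := n.2 ▸ hmono _ _ (by simpa using hfn)
  refine ⟨⟨φ {f}, hidem _⟩, fun hlub => hfm ?_, hjn, fun hle => hfm (hle hfj)⟩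
  refine (show φ {f} ⊆ m.1 from hlub.2 fun x hx y hy => ?_) hfj
  by_contra hym
  obtain rfl := unique y (hjn (le_of_lt (Set.mem_ofPred.1 hx) hy)) hym
  refine (Set.mem_ofPred.1 hx).not_ge ?_
  change φ {y} ⊆ x.1
  exact x.2 ▸ hmono _ _ (by simpa using hy)


/-- If the lattice of closed sets of a convex geometry is algebraic
(every element is the supremum of compact elements below it) or order-scattered,
then it is spatial. -/
theorem stmt_1 {X : Type*} (φ : Set X → Set X)
    (hext : ∀ Y : Set X, Y ⊆ φ Y)
    (hmono : ∀ Y Z : Set X, Y ⊆ Z → φ Y ⊆ φ Z)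
    (hidem : ∀ Y : Set X, φ (φ Y) = φ Y)
    (hempty : φ ∅ = ∅)
    (hae : ∀ A : Set X, φ A = A → ∀ x y : X, x ≠ y → x ∉ A →
      x ∈ φ (A ∪ {y}) → y ∉ φ (A ∪ {x}))
    (halg_or_scat :
      (∀ a : {A : Set X // φ A = A},
        IsLUB {k : {A : Set X // φ A = A} |
          (∀ (S : Set {A : Set X // φ A = A}) (s : {A : Set X // φ A = A}),
            IsLUB S s → k ≤ s →
            ∃ F : Finset {A : Set X // φ A = A}, ↑F ⊆ S ∧
              ∃ t : {A : Set X // φ A = A}, IsLUB (↑F : Set _) t ∧ k ≤ t)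
          ∧ k ≤ a} a)
      ∨ ¬ Nonempty (ℚ ↪o {A : Set X // φ A = A})) :
    ∀ a : {A : Set X // φ A = A},
      IsLUB {j : {A : Set X // φ A = A} |
        ¬ IsLUB {x : {A : Set X // φ A = A} | x < j} j ∧ j ≤ a} a := by
  have hsup : ∀ S : Set {A : Set X // φ A = A}, ∃ s, IsLUB S s := by
    intro S
    refine ⟨⟨φ (⋃ x ∈ S, x.1), hidem _⟩, fun x hx y hy => hext _ (Set.mem_biUnion hx hy), ?_⟩
    intro u hu
    change φ (⋃ x ∈ S, x.1) ⊆ u.1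
    rw [← u.2]
    exact hmono _ _ (Set.iUnion₂_subset fun x hx => hu hx)
  intro a
  obtain ⟨b, hb⟩ := hsup {j | ¬ IsLUB {x | x < j} j ∧ j ≤ a}
  have hba : b ≤ a := hb.2 fun j hj => hj.2
  have no_cover : ∀ m n, b ≤ m → n ≤ a → ¬ m ⋖ n := fun m n hbm hna hmn => by
    obtain ⟨j, hj, hjn, hjm⟩ := exists_joinIrreducible_of_covBy φ hext hmono hidem hae hmn
    exact hjm ((hb.1 ⟨hj, hjn.trans hna⟩).trans hbm)
  suffices b = a from this ▸ hb
  by_contra hne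
  rcases halg_or_scat with halg | hscat
  · refine hne (hba.antisymm ((halg a).2 fun k hk => ?_))
    by_contra hkb
    obtain ⟨m, n, hbm, hmn, hna⟩ := exists_covBy_of_compact hsup hk.1 hk.2 hkb hba
    exact no_cover m n hbm hna hmn
  · exact hscat (nonempty_rat_orderEmbedding_of_not_covBy (hba.lt_of_ne hne) no_cover)
end

section
/- Let (X, φ) be a super solvable convex geometry, that is, a convex geometry for which there exists a well-order ≤_X on X such that for all closed sets A, B with A ⊄ B (A not a subset of B), the set A \ {a} is closed, where a is the ≤_X-least element of A \ B. Then the complete lattice Cl(X, φ) of closed sets, ordered by inclusion, is spatial. -/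
/-- The lattice of closed sets of a super solvable convex geometry
is spatial. -/
theorem stmt_3 {X : Type*} (φ : Set X → Set X)
    (hext : ∀ Y : Set X, Y ⊆ φ Y)
    (hmono : ∀ Y Z : Set X, Y ⊆ Z → φ Y ⊆ φ Z)
    (hidem : ∀ Y : Set X, φ (φ Y) = φ Y)
    (hempty : φ ∅ = ∅)
    (hae : ∀ A : Set X, φ A = A → ∀ x y : X, x ≠ y → x ∉ A →
      x ∈ φ (A ∪ {y}) → y ∉ φ (A ∪ {x}))
    (hss : ∃ r : X → X → Prop, IsWellOrder X r ∧
      ∀ A B : Set X, φ A = A → φ B = B → ¬ A ⊆ B →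
        ∀ a ∈ A \ B, (∀ b ∈ A \ B, ¬ r b a) → φ (A \ {a}) = A \ {a}) :
    ∀ a : {A : Set X // φ A = A},
      IsLUB {j : {A : Set X // φ A = A} |
        ¬ IsLUB {x : {A : Set X // φ A = A} | x < j} j ∧ j ≤ a} a := by
  obtain ⟨r, hr, hss⟩ := hss
  rintro ⟨A, hA⟩
  refine ⟨fun j hj => hj.2, ?_⟩
  rintro ⟨B, hB⟩ hub
  change A ⊆ B
  by_contra hAB
  obtain ⟨a, haAB, hmin⟩ := hr.wf.has_min (A \ B) (Set.sdiff_nonempty.2 hAB)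
  have hAa : φ (A \ {a}) = A \ {a} := hss A B hA hB hAB a haAB hmin
  have hsub : φ {a} ⊆ A := by
    rw [← hA]
    exact hmono _ _ (Set.singleton_subset_iff.2 haAB.1)
  have ha : a ∈ φ {a} := hext _ rfl
  have hlower : φ (φ {a} \ {a}) = φ {a} \ {a} := by
    refine Set.Subset.antisymm (fun x hx => ⟨?_, ?_⟩) (hext _)
    · rw [← hidem {a}]
      exact hmono _ _ Set.sdiff_subset hx
    · have hx' : x ∈ φ (A \ {a}) := hmono _ _ (Set.sdiff_subset_sdiff_left hsub) hx
      rw [hAa] at hx'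
      exact hx'.2
  have hirr : ¬ IsLUB {x : {A : Set X // φ A = A} | x < ⟨φ {a}, hidem {a}⟩}
      ⟨φ {a}, hidem {a}⟩ := by
    intro hlub
    have hle : φ {a} ⊆ φ {a} \ {a} := by
      refine @hlub.2 ⟨φ {a} \ {a}, hlower⟩ ?_
      rintro ⟨C, hC⟩ hlt
      rw [Set.mem_ofPred_eq] at hlt
      refine Set.subset_sdiff_singleton hlt.le fun haC => hlt.not_ge ?_
      change φ {a} ⊆ C
      rw [← hC]
      exact hmono _ _ (Set.singleton_subset_iff.2 haC)
    exact (hle ha).2 rfl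
  have hle : φ {a} ⊆ B := @hub ⟨φ {a}, hidem {a}⟩ ⟨hirr, hsub⟩
  exact haAB.2 (hle ha)
end

section
/- Let V be a real vector space and X ⊆ V. If for every n ∈ ℕ the set X contains a convexly independent subset of cardinality n, then X contains an infinite convexly independent subset. -/
open Filter

/-- A greedy construction: if every finite set satisfying `P` can be enlarged by an element related
to it by `Q` while keeping `P`, then there is a sequence each of whose terms is related by `Q` to
a finite set containing all the earlier terms. -/
lemma exists_seq_of_forall_finset_exists_insert {α : Type*} [DecidableEq α]
    (P : Finset α → Prop) (Q : Finset α → α → Prop) (h0 : P ∅)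
    (h : ∀ A, P A → ∃ x, Q A x ∧ P (insert x A)) :
    ∃ u : ℕ → α, ∀ n, ∃ A : Finset α, (∀ i < n, u i ∈ A) ∧ Q A (u n) := by
  choose φ hQ hP using h
  let A : ℕ → {A : Finset α // P A} :=
    fun n => Nat.rec ⟨∅, h0⟩ (fun _ B => ⟨insert (φ B.1 B.2) B.1, hP B.1 B.2⟩) n
  refine ⟨fun n => φ (A n).1 (A n).2, fun n => ⟨(A n).1, ?_, hQ _ _⟩⟩
  induction n with
  | zero => simp
  | succ n ih =>
    intro i hi
    change _ ∈ insert (φ (A n).1 (A n).2) (A n).1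
    rcases Nat.lt_succ_iff_lt_or_eq.1 hi with hi | rfl
    · exact Finset.mem_insert_of_mem (ih i hi)
    · exact Finset.mem_insert_self _ _

/-- A relation holding on iterated ultrafilter-many triples holds on all increasing triples of
some subsequence. -/
lemma exists_strictMono_of_eventually_triple (T : ℕ → ℕ → ℕ → Prop)
    (h : ∀ᶠ i in (hyperfilter ℕ : Filter ℕ), ∀ᶠ j in (hyperfilter ℕ : Filter ℕ),
      ∀ᶠ k in (hyperfilter ℕ : Filter ℕ), T i j k) :
    ∃ u : ℕ → ℕ, StrictMono u ∧ ∀ i j k, i < j → j < k → T (u i) (u j) (u k) := by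
  have hgt (a : ℕ) : ∀ᶠ k in (hyperfilter ℕ : Filter ℕ), a < k :=
    Nat.hyperfilter_le_atTop (eventually_gt_atTop a)
  obtain ⟨u, hu⟩ := exists_seq_of_forall_finset_exists_insert
    (fun A : Finset ℕ => (∀ i ∈ A, ∀ᶠ j in (hyperfilter ℕ : Filter ℕ),
      ∀ᶠ k in (hyperfilter ℕ : Filter ℕ), T i j k) ∧
      ∀ i ∈ A, ∀ j ∈ A, i < j → ∀ᶠ k in (hyperfilter ℕ : Filter ℕ), T i j k)
    (fun A x => (∀ i ∈ A, i < x) ∧ ∀ i ∈ A, ∀ j ∈ A, i < j → T i j x)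
    (by simp) (by
      rintro A ⟨h1, h2⟩
      have e1 : ∀ᶠ x in (hyperfilter ℕ : Filter ℕ), ∀ i ∈ A, i < x :=
        (eventually_all_finset A).2 fun i _ => hgt i
      have e2 : ∀ᶠ x in (hyperfilter ℕ : Filter ℕ), ∀ i ∈ A, ∀ j ∈ A, i < j → T i j x :=
        (eventually_all_finset A).2 fun i hi => (eventually_all_finset A).2 fun j hj =>
          eventually_imp_distrib_left.2 (h2 i hi j hj)
      have e3 : ∀ᶠ x in (hyperfilter ℕ : Filter ℕ), ∀ i ∈ A,
          ∀ᶠ k in (hyperfilter ℕ : Filter ℕ), T i x k :=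
        (eventually_all_finset A).2 h1
      obtain ⟨x, hx, hx1, hx2, hx3⟩ := (h.and (e1.and (e2.and e3))).exists
      refine ⟨x, ⟨hx1, hx2⟩, ?_, ?_⟩
      · intro i hi
        rcases Finset.mem_insert.1 hi with rfl | hi
        exacts [hx, h1 i hi]
      · intro i hi j hj hij
        rcases Finset.mem_insert.1 hi with rfl | hiA <;>
          rcases Finset.mem_insert.1 hj with rfl | hjA
        · exact absurd hij (lt_irrefl _)
        · exact absurd hij (hx1 j hjA).not_gt
        · exact hx3 i hiA
        · exact h2 i hiA j hjA hij)
  have hmono : StrictMono u := by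
    intro i j hij
    obtain ⟨A, hA, hlt, -⟩ := hu j
    exact hlt _ (hA i hij)
  refine ⟨u, hmono, fun i j k hij hjk => ?_⟩
  obtain ⟨A, hA, -, hT⟩ := hu k
  exact hT _ (hA i (hij.trans hjk)) _ (hA j hjk) (hmono hij)

/-- The infinite Ramsey theorem for triples and two colours. -/
lemma exists_strictMono_triple_or_not (T : ℕ → ℕ → ℕ → Prop) :
    ∃ u : ℕ → ℕ, StrictMono u ∧ ((∀ i j k, i < j → j < k → T (u i) (u j) (u k)) ∨
      ∀ i j k, i < j → j < k → ¬ T (u i) (u j) (u k)) := by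
  by_cases h : ∀ᶠ i in (hyperfilter ℕ : Filter ℕ), ∀ᶠ j in (hyperfilter ℕ : Filter ℕ),
      ∀ᶠ k in (hyperfilter ℕ : Filter ℕ), T i j k
  · obtain ⟨u, hu, hT⟩ := exists_strictMono_of_eventually_triple T h
    exact ⟨u, hu, Or.inl hT⟩
  · simp only [← Ultrafilter.eventually_not] at h
    obtain ⟨u, hu, hT⟩ := exists_strictMono_of_eventually_triple (fun i j k => ¬ T i j k) h
    exact ⟨u, hu, Or.inr hT⟩

/-- Countably many nonzero vectors of a real vector space are simultaneously non-annihilated by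
some linear functional. -/
lemma exists_dual_forall_ne_zero {V : Type*} [AddCommGroup V] [Module ℝ V] (C : Set V)
    (hC : C.Countable) (h0 : ∀ c ∈ C, c ≠ 0) : ∃ f : V →ₗ[ℝ] ℝ, ∀ c ∈ C, f c ≠ 0 := by
  classical
  let b := Module.Basis.ofVectorSpace ℝ V
  obtain ⟨e, he⟩ := Set.countable_iff_exists_injOn.1
    (hC.biUnion fun c _ => (b.repr c).support.countable_toSet)
  let L : V →ₗ[ℝ] Polynomial ℝ := b.constr ℝ fun i => (Polynomial.X : Polynomial ℝ) ^ e i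
  have hL : ∀ c ∈ C, L c ≠ 0 := by
    intro c hc hLc
    obtain ⟨i, hi⟩ : ∃ i, b.repr c i ≠ 0 := by
      by_contra! hz
      exact h0 c hc (b.repr.map_eq_zero_iff.1 (Finsupp.ext hz))
    have hmem : ∀ j ∈ (b.repr c).support, j ∈ ⋃ c ∈ C, ((b.repr c).support : Set _) :=
      fun j hj => Set.mem_biUnion hc hj
    have hco : (L c).coeff (e i) = b.repr c i := by
      rw [show L c = _ from b.constr_apply ℝ _ c, Finsupp.sum, Polynomial.finsetSum_coeff,
        Finset.sum_eq_single i]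
      · simp
      · intro j hj hji
        have : e i ≠ e j := fun hij =>
          hji (he (hmem i (Finsupp.mem_support_iff.2 hi)) (hmem j hj) hij).symm
        simp [Polynomial.coeff_X_pow, this]
      · intro hn
        exact absurd (Finsupp.mem_support_iff.2 hi) hn
    rw [hLc, Polynomial.coeff_zero] at hco
    exact hi hco.symm
  have hroots : (⋃ c ∈ C, ((L c).roots.toFinset : Set ℝ)).Countable :=
    hC.biUnion fun c _ => (L c).roots.toFinset.countable_toSet
  obtain ⟨t, ht⟩ : ∃ t, t ∉ ⋃ c ∈ C, ((L c).roots.toFinset : Set ℝ) := by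
    by_contra! hall
    exact Set.not_countable_univ (α := ℝ) (hroots.mono fun t _ => hall t)
  refine ⟨(Polynomial.leval t).comp L, fun c hc hz => ht (Set.mem_biUnion hc ?_)⟩
  simpa [hL c hc] using hz

/-- A set with arbitrarily large finite convexly independent subsets is not covered by finitely
many lines. -/
lemma exists_mem_forall_notMem_line {V : Type*} [AddCommGroup V] [Module ℝ V] (X : Set V)
    (h : ∀ n : ℕ, ∃ Y : Finset V, ↑Y ⊆ X ∧ Y.card = n ∧
      ∀ y ∈ (Y : Set V), y ∉ convexHull ℝ ((Y : Set V) \ {y})) (A : Finset V) :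
    ∃ x ∈ X, ∀ a ∈ A, ∀ b ∈ A, x ∉ line[ℝ, a, b] := by
  classical
  by_contra! hcov
  obtain ⟨Y, hYX, hcard, hY⟩ := h ((A ×ˢ A).card * 2 + 1)
  choose! a ha b hb hab using hcov
  obtain ⟨p, -, hp⟩ := Finset.exists_lt_card_fiber_of_mul_lt_card_of_maps_to
    (s := Y) (t := A ×ˢ A) (f := fun x => (a x, b x)) (n := 2)
    (fun x hx => Finset.mem_product.2 ⟨ha x (hYX hx), hb x (hYX hx)⟩) (by omega)
  obtain ⟨x, y, z, hx, hy, hz, hxy, hxz, hyz⟩ := Finset.two_lt_card_iff.1 hp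
  have hline : ∀ w ∈ Y.filter (fun x => (a x, b x) = p), w ∈ Y ∧ w ∈ line[ℝ, p.1, p.2] := by
    intro w hw
    obtain ⟨hwY, rfl⟩ := Finset.mem_filter.1 hw
    exact ⟨hwY, hab w (hYX hwY)⟩
  obtain ⟨hx, hxl⟩ := hline x hx
  obtain ⟨hy, hyl⟩ := hline y hy
  obtain ⟨hz, hzl⟩ := hline z hz
  have key : ∀ u ∈ Y, ∀ v ∈ Y, ∀ w ∈ Y, u ≠ v → w ≠ v → ¬ Wbtw ℝ u v w := by
    intro u hu v hv w hw huv hwv hb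
    exact hY v hv (segment_subset_convexHull (s := (Y : Set V) \ {v}) ⟨hu, huv⟩ ⟨hw, hwv⟩
      (mem_segment_iff_wbtw.2 hb))
  rcases (collinear_triple_of_mem_affineSpan_pair hxl hyl hzl).wbtw_or_wbtw_or_wbtw with
    hb | hb | hb
  · exact key x hx y hy z hz hxy hyz.symm hb
  · exact key y hy z hz x hx hyz hxz hb
  · exact key z hz x hx y hy hxz.symm hxy.symm hb

/-- Twice the signed area of the image of the triangle `x y z` under `(F, G)`. -/
def signedArea {V : Type*} [AddCommGroup V] [Module ℝ V] (F G : V →ₗ[ℝ] ℝ) (x y z : V) : ℝ :=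
  F (y - x) * G (z - x) - F (z - x) * G (y - x)

lemma signedArea_rotate {V : Type*} [AddCommGroup V] [Module ℝ V] (F G : V →ₗ[ℝ] ℝ)
    (x y z : V) : signedArea F G y z x = signedArea F G x y z := by
  simp only [signedArea, map_sub]
  ring

/-- A sequence all of whose increasing triples are positively oriented in some planar projection
has an infinite convexly independent set of terms. -/
lemma exists_infinite_convexIndependent_of_signedArea_pos {V : Type*} [AddCommGroup V]
    [Module ℝ V] (F G : V →ₗ[ℝ] ℝ) (v : ℕ → V) (hv : Function.Injective v)
    (h : ∀ i j k, i < j → j < k → 0 < signedArea F G (v i) (v j) (v k)) :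
    ∃ Y ⊆ Set.range v, Y.Infinite ∧ ∀ y ∈ Y, y ∉ convexHull ℝ (Y \ {y}) := by
  refine ⟨Set.range fun n => v (2 * n + 1), ?_, Set.infinite_range_of_injective ?_, ?_⟩
  · rintro _ ⟨n, rfl⟩
    exact ⟨_, rfl⟩
  · intro m n hmn
    have := hv hmn
    omega
  · rintro _ ⟨n, rfl⟩ hmem
    let f : V →ₗ[ℝ] ℝ := F (v (2 * n + 1) - v (2 * n)) • G - G (v (2 * n + 1) - v (2 * n)) • F
    have hf (x : V) : signedArea F G (v (2 * n)) (v (2 * n + 1)) x = f x - f (v (2 * n)) := by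
      simp only [signedArea, f, map_sub, LinearMap.sub_apply, LinearMap.smul_apply, smul_eq_mul]
      ring
    have hconv : Convex ℝ {x | f (v (2 * n)) < f x} := convex_halfSpace_gt f.isLinear _
    have hlt := convexHull_min (t := {x | f (v (2 * n)) < f x}) (by
      rintro _ ⟨⟨m, rfl⟩, hne⟩
      have hmn : m ≠ n := by
        rintro rfl
        exact hne rfl
      have hpos : 0 < signedArea F G (v (2 * n)) (v (2 * n + 1)) (v (2 * m + 1)) := by
        rcases lt_or_gt_of_ne hmn with hlt | hgt
        · rw [signedArea_rotate]
          exact h _ _ _ (by omega) (by omega)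
        · exact h _ _ _ (by omega) (by omega)
      rw [hf] at hpos
      exact sub_pos.1 hpos) hconv hmem
    have hzero : signedArea F G (v (2 * n)) (v (2 * n + 1)) (v (2 * n + 1)) = 0 := by
      simp only [signedArea]
      ring
    rw [hf] at hzero
    exact (sub_pos.2 hlt).ne' hzero

/-- A sequence without collinear triples has a planar projection without collinear triples. -/
lemma exists_signedArea_ne_zero {V : Type*} [AddCommGroup V] [Module ℝ V] (v : ℕ → V)
    (hv : Function.Injective v) (hl : ∀ i j k, i < j → j < k → v k ∉ line[ℝ, v i, v j]) :
    ∃ F G : V →ₗ[ℝ] ℝ, ∀ i j k, i < j → j < k → signedArea F G (v i) (v j) (v k) ≠ 0 := by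
  obtain ⟨F, hF⟩ := exists_dual_forall_ne_zero
    ((fun p : ℕ × ℕ => v p.2 - v p.1) '' {p | p.1 < p.2}) ((Set.to_countable _).image _) (by
      rintro _ ⟨p, hp, rfl⟩
      exact sub_ne_zero.2 (hv.ne (Set.mem_ofPred_eq ▸ hp).ne'))
  have hF' (i j : ℕ) (hij : i < j) : F (v j - v i) ≠ 0 := hF _ ⟨(i, j), hij, rfl⟩
  obtain ⟨G, hG⟩ := exists_dual_forall_ne_zero
    ((fun p : ℕ × ℕ × ℕ => F (v p.2.1 - v p.1) • (v p.2.2 - v p.1) -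
      F (v p.2.2 - v p.1) • (v p.2.1 - v p.1)) '' {p | p.1 < p.2.1 ∧ p.2.1 < p.2.2})
    ((Set.to_countable _).image _) (by
      rintro _ ⟨⟨i, j, k⟩, ⟨hij, hjk⟩, rfl⟩ hz
      have hne := hF' i j hij
      apply hl i j k hij hjk
      have hk : v k = AffineMap.lineMap (v i) (v j)
          ((F (v j - v i))⁻¹ * F (v k - v i)) := by
        rw [AffineMap.lineMap_apply, vsub_eq_sub, vadd_eq_add, mul_smul,
          ← sub_eq_zero.1 hz, smul_smul, inv_mul_cancel₀ hne, one_smul, sub_add_cancel]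
      rw [hk]
      exact AffineMap.lineMap_mem_affineSpan_pair _ _ _)
  refine ⟨F, G, fun i j k hij hjk => ?_⟩
  simpa [signedArea] using hG _ ⟨(i, j, k), ⟨hij, hjk⟩, rfl⟩

/-- If X contains convexly independent subsets of every finite
cardinality, then it contains an infinite convexly independent subset. -/
theorem stmt_6 {V : Type*} [AddCommGroup V] [Module ℝ V] (X : Set V)
    (h : ∀ n : ℕ, ∃ Y : Finset V, ↑Y ⊆ X ∧ Y.card = n ∧
      ∀ y ∈ (Y : Set V), y ∉ convexHull ℝ ((Y : Set V) \ {y})) :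
    ∃ Y : Set V, Y ⊆ X ∧ Y.Infinite ∧ ∀ y ∈ Y, y ∉ convexHull ℝ (Y \ {y}) := by
  classical
  obtain ⟨v, hv⟩ := exists_seq_of_forall_finset_exists_insert (fun _ : Finset V => True)
    (fun A x => x ∈ X ∧ ∀ a ∈ A, ∀ b ∈ A, x ∉ line[ℝ, a, b]) trivial
    (fun A _ => by simpa using exists_mem_forall_notMem_line X h A)
  have hvX (n : ℕ) : v n ∈ X := (hv n).choose_spec.2.1
  have hl (i j k : ℕ) (hik : i < k) (hjk : j < k) : v k ∉ line[ℝ, v i, v j] := by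
    obtain ⟨A, hA, -, hQ⟩ := hv k
    exact hQ _ (hA i hik) _ (hA j hjk)
  have hne (i j : ℕ) (hij : i < j) : v i ≠ v j := fun heq =>
    hl i i j hij hij (heq ▸ left_mem_affineSpan_pair ℝ (v i) (v i))
  have hinj : Function.Injective v := fun i j heq => by
    by_contra hij
    rcases lt_or_gt_of_ne hij with hij | hij
    exacts [hne _ _ hij heq, hne _ _ hij heq.symm]
  obtain ⟨F, G, hFG⟩ := exists_signedArea_ne_zero v hinj
    fun i j k hij hjk => hl i j k (hij.trans hjk) hjk
  obtain ⟨u, hu, hT⟩ := exists_strictMono_triple_or_not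
    fun i j k => 0 < signedArea F G (v i) (v j) (v k)
  obtain ⟨G', hG'⟩ : ∃ G' : V →ₗ[ℝ] ℝ, ∀ i j k, i < j → j < k →
      0 < signedArea F G' (v (u i)) (v (u j)) (v (u k)) := by
    rcases hT with hT | hT
    · exact ⟨G, hT⟩
    · refine ⟨-G, fun i j k hij hjk => ?_⟩
      have hneg := lt_of_le_of_ne (not_lt.1 (hT i j k hij hjk)) (hFG _ _ _ (hu hij) (hu hjk))
      simp only [signedArea, LinearMap.neg_apply] at hneg ⊢
      linarith
  obtain ⟨Y, hY, hYinf, hYind⟩ := exists_infinite_convexIndependent_of_signedArea_pos F G'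
    (v ∘ u) (hinj.comp hu.injective) hG'
  refine ⟨Y, hY.trans ?_, hYinf, hYind⟩
  rintro _ ⟨n, rfl⟩
  exact hvX _
end

section
/- Let V be a real vector space and X ⊆ V an infinite set. Let K = {conv(F) ∩ X : F a finite subset of X}, which is a join-semilattice under the operation (A, B) ↦ conv(A ∪ B) ∩ X (this is the semilattice of compact elements of Co(V, X)). Then there is an injective join-preserving map into K either from the join-semilattice of finite intervals of ℕ (finite order-convex subsets of ℕ, with join of I and J the smallest interval containing I ∪ J), or from the join-semilattice of finite subsets of ℕ under union. -/
/-- The smallest order-convex subset of ℕ containing `S`. -/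
def ordHull (S : Set ℕ) : Set ℕ := {b : ℕ | ∃ a ∈ S, ∃ c ∈ S, a ≤ b ∧ b ≤ c}

open Filter in
/-- Infinite Ramsey theorem for triples of natural numbers and finitely many colours. -/
theorem exists_strictMono_homogeneous_triples {κ : Type*} [Finite κ] (c : ℕ → ℕ → ℕ → κ) :
    ∃ (k : κ) (φ : ℕ → ℕ), StrictMono φ ∧
      ∀ i j l, i < j → j < l → c (φ i) (φ j) (φ l) = k := by
  classical
  set U : Ultrafilter ℕ := hyperfilter ℕ
  have limit (d : ℕ → κ) : ∃ k, ∀ᶠ n in U, d n = k :=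
    Ultrafilter.eventually_exists_iff.1 (Eventually.of_forall fun n => ⟨d n, rfl⟩)
  choose c₂ hc₂ using fun i j => limit (c i j)
  choose c₁ hc₁ using fun i => limit (c₂ i)
  obtain ⟨k, hk⟩ := limit c₁
  let Good (s : Finset ℕ) : Prop := (∀ i ∈ s, c₁ i = k) ∧
    (∀ i ∈ s, ∀ j ∈ s, i < j → c₂ i j = k) ∧
    ∀ i ∈ s, ∀ j ∈ s, ∀ l ∈ s, i < j → j < l → c i j l = k
  have extend (s : {s // Good s}) : ∃ t : {t // Good t}, s.1 ⊂ t.1 := by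
    obtain ⟨s, h₁, h₂, h₃⟩ := s
    have e₁ : ∀ᶠ n in U, ∀ i ∈ s, c₂ i n = k := by
      rw [eventually_all_finset]
      intro i hi
      filter_upwards [hc₁ i] with n hn
      rw [hn, h₁ i hi]
    have e₂ : ∀ᶠ n in U, ∀ i ∈ s, ∀ j ∈ s, i < j → c i j n = k := by
      rw [eventually_all_finset]
      intro i hi
      rw [eventually_all_finset]
      intro j hj
      filter_upwards [hc₂ i j] with n hn hij
      rw [hn, h₂ i hi j hj hij]
    have e₃ : ∀ᶠ n in U, ∀ i ∈ s, i < n := by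
      rw [eventually_all_finset]
      exact fun i _ => Nat.hyperfilter_le_atTop (eventually_gt_atTop i)
    obtain ⟨n, hn, hn₁, hn₂, hn₃⟩ := (hk.and (e₁.and (e₂.and e₃))).exists
    refine ⟨⟨insert n s, ?_, ?_, ?_⟩, Finset.ssubset_insert fun h => (hn₃ n h).false⟩
    · grind
    · grind
    · grind
  choose next hnext using extend
  let S : ℕ → {s // Good s} := fun n => Nat.rec ⟨∅, by simp [Good]⟩ (fun _ s => next s) n
  have hS : StrictMono fun n => (S n).1 := strictMono_nat_of_lt_succ fun n => hnext (S n)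
  let T : Set ℕ := ⋃ n, ((S n).1 : Set ℕ)
  have hT : T.Infinite := by
    intro hfin
    have hsub (n : ℕ) : (S n).1 ⊆ hfin.toFinset := fun i hi =>
      hfin.mem_toFinset.2 (Set.mem_iUnion.2 ⟨n, hi⟩)
    have hcard : StrictMono fun n => (S n).1.card := Finset.card_strictMono.comp hS
    have := Finset.card_le_card (hsub (hfin.toFinset.card + 1))
    have := hcard.le_apply (x := hfin.toFinset.card + 1)
    lia
  have hmono := Nat.nth_strictMono (p := (· ∈ T)) hT
  refine ⟨k, Nat.nth (· ∈ T), hmono, fun i j l hij hjl => ?_⟩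
  have hmem (i : ℕ) : ∃ n, Nat.nth (· ∈ T) i ∈ (S n).1 := by
    simpa [T] using Nat.nth_mem_of_infinite (p := (· ∈ T)) hT i
  obtain ⟨a, ha⟩ := hmem i
  obtain ⟨b, hb⟩ := hmem j
  obtain ⟨d, hd⟩ := hmem l
  have hle {m n : ℕ} (h : m ≤ n) : (S m).1 ⊆ (S n).1 := hS.monotone h
  exact (S (a ⊔ b ⊔ d)).2.2.2 _ (hle (by simp) ha) _ (hle (by simp) hb) _ (hle (by simp) hd)
    (hmono hij) (hmono hjl)

section Convex

variable {V : Type*} [AddCommGroup V] [Module ℝ V]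

theorem LinearIndependent.convexIndependent_real {ι : Type*} {x : ι → V}
    (hx : LinearIndependent ℝ x) : ConvexIndependent ℝ x := by
  intro s i hi
  by_contra his
  exact hx.notMem_span_image his
    (convexHull_min Submodule.subset_span (Submodule.convex (Submodule.span ℝ (x '' s))) hi)

theorem convexIndependent_of_forall_lt {ι : Type*} {x : ι → V} (ℓ : ι → V →ₗ[ℝ] ℝ)
    (h : ∀ i j, j ≠ i → ℓ i (x i) < ℓ i (x j)) : ConvexIndependent ℝ x := by
  intro s i hi
  by_contra his
  have hsub : convexHull ℝ (x '' s) ⊆ {v | ℓ i (x i) < ℓ i v} := by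
    refine convexHull_min ?_ (convex_halfSpace_gt (ℓ i).isLinear _)
    rintro _ ⟨j, hj, rfl⟩
    exact h i j fun hji => his (hji ▸ hj)
  exact (lt_irrefl (ℓ i (x i))) (hsub hi)

/-- Points whose projections by `(f, g)` turn strictly left are in convex position, at least
once the first of them is discarded. -/
theorem convexIndependent_of_orientation_pos {x : ℕ → V} (f g : V →ₗ[ℝ] ℝ)
    (h : ∀ i j k, i < j → j < k →
      0 < (f (x j) - f (x i)) * (g (x k) - g (x i)) - (f (x k) - f (x i)) * (g (x j) - g (x i))) :
    ConvexIndependent ℝ fun n => x (n + 1) := by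
  refine convexIndependent_of_forall_lt
    (fun n => (f (x (n + 2)) - f (x n)) • g - (g (x (n + 2)) - g (x n)) • f) fun n m hm => ?_
  have hn := h n (n + 1) (n + 2) (by lia) (by lia)
  simp only [LinearMap.sub_apply, LinearMap.smul_apply, smul_eq_mul]
  obtain hlt | rfl | rfl | hlt :
      m + 1 < n ∨ n = m + 1 ∨ m = n + 1 ∨ n + 2 < m + 1 := by lia
  · nlinarith only [hn, h (m + 1) n (n + 2) hlt (by lia)]
  · nlinarith only [hn]
  · nlinarith only [hn]
  · nlinarith only [hn, h n (n + 2) (m + 1) (by lia) hlt]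

theorem convexHull_union_inter_inter {A B X : Set V} (hA : A ⊆ X) (hB : B ⊆ X) :
    convexHull ℝ (convexHull ℝ A ∩ X ∪ convexHull ℝ B ∩ X) = convexHull ℝ (A ∪ B) := by
  apply subset_antisymm
  · refine convexHull_min (Set.union_subset ?_ ?_) (convex_convexHull ℝ _)
    · exact Set.inter_subset_left.trans (convexHull_mono Set.subset_union_left)
    · exact Set.inter_subset_left.trans (convexHull_mono Set.subset_union_right)
  · exact convexHull_mono (Set.union_subset_union
      (Set.subset_inter (subset_convexHull ℝ A) hA) (Set.subset_inter (subset_convexHull ℝ B) hB))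

theorem exists_finset_embedding_of_convexIndependent {X : Set V} {x : ℕ → V}
    (hxX : ∀ n, x n ∈ X) (hx : ConvexIndependent ℝ x) :
    ∃ h : Finset ℕ → Set V,
      (∀ s : Finset ℕ, ∃ F : Finset V, ↑F ⊆ X ∧ h s = convexHull ℝ (↑F : Set V) ∩ X) ∧
      Function.Injective h ∧
      (∀ s t : Finset ℕ, h (s ∪ t) = convexHull ℝ (h s ∪ h t) ∩ X) := by
  classical
  have hsub (s : Set ℕ) : x '' s ⊆ X := by
    rintro _ ⟨n, -, rfl⟩
    exact hxX n
  refine ⟨fun s => convexHull ℝ (x '' s) ∩ X, fun s => ⟨s.image x, ?_, ?_⟩, fun s t hst => ?_,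
    fun s t => ?_⟩
  · simpa using hsub s
  · simp
  · have hmem (s : Finset ℕ) (n : ℕ) : n ∈ s ↔ x n ∈ convexHull ℝ (x '' s) ∩ X := by
      simp [hx.mem_convexHull_iff, hxX]
    ext n
    rw [hmem s, hmem t]
    exact Set.ext_iff.1 hst (x n)
  · simp only
    rw [convexHull_union_inter_inter (hsub _) (hsub _), Finset.coe_union, Set.image_union]

theorem exists_interval_embedding_of_mem_segment {X : Set V} {x : ℕ → V} (hxX : ∀ n, x n ∈ X)
    (f : V →ₗ[ℝ] ℝ) (hf : StrictMono fun n => f (x n))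
    (hx : ∀ i j k, i < j → j < k → x j ∈ segment ℝ (x i) (x k)) :
    ∃ h : Set ℕ → Set V,
      (∀ I : Set ℕ, I.Finite → I.OrdConnected →
        ∃ F : Finset V, ↑F ⊆ X ∧ h I = convexHull ℝ (↑F : Set V) ∩ X) ∧
      (∀ I J : Set ℕ, I.Finite → I.OrdConnected → J.Finite → J.OrdConnected →
        h I = h J → I = J) ∧
      (∀ I J : Set ℕ, I.Finite → I.OrdConnected → J.Finite → J.OrdConnected →
        h (ordHull (I ∪ J)) = convexHull ℝ (h I ∪ h J) ∩ X) := by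
  have hsub (s : Set ℕ) : x '' s ⊆ X := by
    rintro _ ⟨n, -, rfl⟩
    exact hxX n
  refine ⟨fun I => convexHull ℝ (x '' I) ∩ X, fun I hI _ => ⟨(hI.image x).toFinset, ?_, ?_⟩,
    fun I J _ hI _ hJ hIJ => ?_, fun I J _ _ _ _ => ?_⟩
  · simpa using hsub I
  · simp
  · have hmem (I : Set ℕ) (hI : I.OrdConnected) (n : ℕ) :
        n ∈ I ↔ x n ∈ convexHull ℝ (x '' I) ∩ X := by
      refine ⟨fun hn => ⟨subset_convexHull ℝ _ ⟨n, hn, rfl⟩, hxX n⟩, fun ⟨hn, _⟩ => ?_⟩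
      obtain ⟨a, ha, han⟩ : ∃ a ∈ I, a ≤ n := by
        by_contra! hlt
        have : convexHull ℝ (x '' I) ⊆ {v | f (x n) < f v} := by
          refine convexHull_min ?_ (convex_halfSpace_gt f.isLinear _)
          rintro _ ⟨a, ha, rfl⟩
          exact hf (hlt a ha)
        exact lt_irrefl (f (x n)) (this hn)
      obtain ⟨b, hb, hnb⟩ : ∃ b ∈ I, n ≤ b := by
        by_contra! hlt
        have : convexHull ℝ (x '' I) ⊆ {v | f v < f (x n)} := by
          refine convexHull_min ?_ (convex_halfSpace_lt f.isLinear _)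
          rintro _ ⟨a, ha, rfl⟩
          exact hf (hlt a ha)
        exact lt_irrefl (f (x n)) (this hn)
      exact hI.out ha hb ⟨han, hnb⟩
    ext n
    rw [hmem I hI, hmem J hJ]
    exact Set.ext_iff.1 hIJ (x n)
  · simp only
    rw [convexHull_union_inter_inter (hsub _) (hsub _), ← Set.image_union]
    congr 1
    apply subset_antisymm
    · refine convexHull_min ?_ (convex_convexHull ℝ _)
      rintro _ ⟨b, ⟨a, ha, c, hc, hab, hbc⟩, rfl⟩
      have ha' := subset_convexHull ℝ _ (Set.mem_image_of_mem x ha)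
      have hc' := subset_convexHull ℝ _ (Set.mem_image_of_mem x hc)
      obtain rfl | hab := hab.eq_or_lt
      · exact ha'
      obtain rfl | hbc := hbc.eq_or_lt
      · exact hc'
      exact (convex_convexHull ℝ _).segment_subset ha' hc' (hx a b c hab hbc)
    · exact convexHull_mono (Set.image_mono fun n hn => ⟨n, hn, n, hn, le_rfl, le_rfl⟩)

theorem exists_strictMono_apply_of_infinite_image {X : Set V} (f : V →ₗ[ℝ] ℝ)
    (hf : (f '' X).Infinite) :
    ∃ (f' : V →ₗ[ℝ] ℝ) (x : ℕ → V), (∀ n, x n ∈ X) ∧ StrictMono fun n => f' (x n) := by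
  let e := hf.natEmbedding
  choose u huX hu using fun n => (e n).2
  have hinj : Function.Injective fun n => f (u n) := by
    intro m n hmn
    simp only [hu] at hmn
    exact e.injective (Subtype.ext hmn)
  obtain ⟨φ, hφ | hφ⟩ := exists_increasing_or_nonincreasing_subseq (· < ·) fun n => f (u n)
  · exact ⟨f, u ∘ φ, fun n => huX _, fun m n hmn => hφ m n hmn⟩
  · refine ⟨-f, u ∘ φ, fun n => huX _, fun m n hmn => ?_⟩
    have hne : f (u (φ n)) ≠ f (u (φ m)) := hinj.ne (φ.injective.ne hmn.ne')
    have := lt_of_le_of_ne (not_lt.1 (hφ m n hmn)) hne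
    simpa using this

theorem exists_convexIndependent_or_mem_segment {ι : Type*} [Finite ι] {X : Set V}
    (hX : X.Infinite) (L : V →ₗ[ℝ] ι → ℝ) (hL : Set.InjOn L (Submodule.span ℝ X)) :
    (∃ x : ℕ → V, (∀ n, x n ∈ X) ∧ ConvexIndependent ℝ x) ∨
    ∃ (f : V →ₗ[ℝ] ℝ) (x : ℕ → V), (∀ n, x n ∈ X) ∧ (StrictMono fun n => f (x n)) ∧
      ∀ i j k, i < j → j < k → x j ∈ segment ℝ (x i) (x k) := by
  let g (a : ι) : V →ₗ[ℝ] ℝ := LinearMap.proj a ∘ₗ L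
  obtain ⟨a, ha⟩ : ∃ a, (g a '' X).Infinite := by
    by_contra! hfin
    refine hX (Set.Finite.of_finite_image ((Set.Finite.pi' hfin).subset ?_)
      (hL.mono Submodule.subset_span))
    rintro _ ⟨v, hv, rfl⟩ a
    exact ⟨v, hv, rfl⟩
  obtain ⟨f, u, huX, hu⟩ := exists_strictMono_apply_of_infinite_image (g a) ha
  obtain ⟨σ, φ, hφ, hσ⟩ := exists_strictMono_homogeneous_triples fun i j k (a : ι) =>
    SignType.sign ((f (u j) - f (u i)) * (g a (u k) - g a (u i)) -
      (f (u k) - f (u i)) * (g a (u j) - g a (u i)))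
  by_cases hzero : ∀ a, σ a = 0
  · refine Or.inr ⟨f, u ∘ φ, fun n => huX _, hu.comp hφ, fun i j k hij hjk => ?_⟩
    have h₁ := hu (hφ hij)
    have h₂ := hu (hφ hjk)
    simp only [Function.comp_apply] at h₁ h₂ ⊢
    have hpos : 0 < f (u (φ k)) - f (u (φ i)) := by linarith
    rw [segment_eq_image]
    refine ⟨(f (u (φ j)) - f (u (φ i))) / (f (u (φ k)) - f (u (φ i))),
      ⟨div_nonneg (by linarith) hpos.le, (div_le_one hpos).2 (by linarith)⟩, ?_⟩
    have hmem (n : ℕ) : u n ∈ Submodule.span ℝ X := Submodule.subset_span (huX n)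
    apply hL (Submodule.add_mem _ (Submodule.smul_mem _ _ (hmem _))
      (Submodule.smul_mem _ _ (hmem _))) (hmem _)
    ext b
    have hb := congrFun (hσ i j k hij hjk) b
    rw [hzero b, sign_eq_zero_iff] at hb
    simp only [g, LinearMap.comp_apply, LinearMap.proj_apply] at hb
    simp only [map_add, map_smul, Pi.add_apply, Pi.smul_apply, smul_eq_mul]
    field_simp
    linarith
  · left
    push Not at hzero
    obtain ⟨b, hb⟩ := hzero
    refine ⟨fun n => u (φ (n + 1)), fun n => huX _, ?_⟩
    obtain hneg | hpos := lt_or_gt_of_ne hb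
    · refine convexIndependent_of_orientation_pos (x := u ∘ φ) f (-g b) fun i j k hij hjk => ?_
      have h := congrFun (hσ i j k hij hjk) b
      rw [SignType.neg_iff.1 hneg, sign_eq_neg_one_iff] at h
      simp only [Function.comp_apply, LinearMap.neg_apply]
      linarith
    · refine convexIndependent_of_orientation_pos (x := u ∘ φ) f (g b) fun i j k hij hjk => ?_
      have h := congrFun (hσ i j k hij hjk) b
      rw [SignType.pos_iff.1 hpos, sign_eq_one_iff] at h
      exact h

end Convex

/-- If X ⊆ V is infinite, then the join-semilattice K of compact
elements of Co(V,X) (the sets conv(F) ∩ X for finite F ⊆ X, with join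
(A,B) ↦ conv(A ∪ B) ∩ X) receives an injective join-preserving map either from
the join-semilattice of finite intervals of ℕ or from the join-semilattice of
finite subsets of ℕ under union. -/
theorem stmt_7 {V : Type*} [AddCommGroup V] [Module ℝ V] (X : Set V)
    (hX : X.Infinite) :
    (∃ h : Set ℕ → Set V,
      (∀ I : Set ℕ, I.Finite → I.OrdConnected →
        ∃ F : Finset V, ↑F ⊆ X ∧ h I = convexHull ℝ (↑F : Set V) ∩ X) ∧
      (∀ I J : Set ℕ, I.Finite → I.OrdConnected → J.Finite → J.OrdConnected →
        h I = h J → I = J) ∧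
      (∀ I J : Set ℕ, I.Finite → I.OrdConnected → J.Finite → J.OrdConnected →
        h (ordHull (I ∪ J)) = convexHull ℝ (h I ∪ h J) ∩ X))
    ∨
    (∃ h : Finset ℕ → Set V,
      (∀ s : Finset ℕ, ∃ F : Finset V, ↑F ⊆ X ∧ h s = convexHull ℝ (↑F : Set V) ∩ X) ∧
      Function.Injective h ∧
      (∀ s t : Finset ℕ, h (s ∪ t) = convexHull ℝ (h s ∪ h t) ∩ X)) := by
  obtain ⟨t, htX, hspan, ht⟩ := exists_linearIndependent ℝ X
  obtain hfin | hinf := t.finite_or_infinite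
  · have : FiniteDimensional ℝ (Submodule.span ℝ X) := by
      rw [← hspan]
      exact FiniteDimensional.span_of_finite ℝ hfin
    let e := (Module.finBasis ℝ (Submodule.span ℝ X)).equivFun
    obtain ⟨L, hL⟩ := LinearMap.exists_extend e.toLinearMap
    have hinj : Set.InjOn L (Submodule.span ℝ X) := by
      intro v hv w hw hvw
      have hLe (v : Submodule.span ℝ X) : L v = e v := LinearMap.congr_fun hL v
      have := e.injective ((hLe ⟨v, hv⟩).symm.trans (hvw.trans (hLe ⟨w, hw⟩)))
      exact congrArg Subtype.val this
    obtain ⟨x, hxX, hx⟩ | ⟨f, x, hxX, hf, hx⟩ :=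
      exists_convexIndependent_or_mem_segment hX L hinj
    · exact Or.inr (exists_finset_embedding_of_convexIndependent hxX hx)
    · exact Or.inl (exists_interval_embedding_of_mem_segment hxX f hf hx)
  · let e := hinf.natEmbedding
    exact Or.inr (exists_finset_embedding_of_convexIndependent (x := fun n => (e n : V))
      (fun n => htX (e n).2) (ht.comp e e.injective).convexIndependent_real)
end

section
/- Let C be a linear order and let Int(C) be the set of order-convex subsets of C (sets A such that x, y ∈ A and x ≤ z ≤ y imply z ∈ A), ordered by inclusion. The following are equivalent: (a) Int(C), with the topology induced from the product topology on the power set of C, is a scattered topological space; (b) there is no order-embedding of ℚ into (Int(C), ⊆); (c) there is no order-embedding of ℚ into the poset of sets [a, b] = {z : a ≤ z ≤ b} for a ≤ b in C, ordered by inclusion; (d) there is no order-embedding of ℚ into C. -/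
open Classical in
/-- The product topology on the power set of `α`, viewed as the product of `α`
copies of the two-element discrete space. -/
noncomputable def cantorTop (α : Type*) : TopologicalSpace (Set α) :=
  TopologicalSpace.induced (fun (A : Set α) (x : α) => decide (x ∈ A)) inferInstance

/-- `S` is a scattered subspace of `(Y, t)`: every nonempty subset of `S` has a
point isolated in its subspace topology. -/
def ScatteredIn {Y : Type*} (t : TopologicalSpace Y) (S : Set Y) : Prop :=
  ∀ T : Set Y, T ⊆ S → T.Nonempty → ∃ x ∈ T, ∃ U : Set Y, t.IsOpen U ∧ T ∩ U = {x}

open Set Topology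

/-- A nonempty linear order in which every point is a limit from the left or from the right
contains a copy of the rationals. -/
theorem nonempty_rat_orderEmbedding_of_limit_points {β : Type*} [LinearOrder β] [Nonempty β]
    (h : ∀ x : β, ¬((IsMin x ∨ ∃ y, y ⋖ x) ∧ (IsMax x ∨ ∃ y, x ⋖ y))) :
    Nonempty (ℚ ↪o β) := by
  let D : Set β := {x | ¬∃ y, y ⋖ x}
  have mem_of_covBy : ∀ {x y : β}, x ⋖ y → x ∈ D := fun {x y} hxy hx ↦
    h x ⟨Or.inr hx, Or.inr ⟨y, hxy⟩⟩
  have exists_between_of_mem : ∀ {x y : β}, y ∈ D → x < y → ∃ z, x < z ∧ z < y := by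
    intro x y hy hxy
    by_contra! hz
    exact hy ⟨x, hxy, fun z hxz hzy ↦ (hz z hxz).not_gt hzy⟩
  have dense : ∀ {x y : β}, y ∈ D → x < y → ∃ z ∈ D, x < z ∧ z < y := by
    intro x y hy hxy
    obtain ⟨z, hxz, hzy⟩ := exists_between_of_mem hy hxy
    by_cases hz : z ∈ D
    · exact ⟨z, hz, hxz, hzy⟩
    obtain ⟨z', hzz', hzy'⟩ := exists_between_of_mem hy hzy
    by_cases hz' : z' ∈ D
    · exact ⟨z', hz', hxz.trans hzz', hzy'⟩
    obtain ⟨w, hw⟩ := not_not.mp hz'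
    exact ⟨w, mem_of_covBy hw, hxz.trans_le (hw.le_of_lt hzz'), hw.lt.trans hzy'⟩
  have exists_mem_le : ∀ b : β, ∃ a ∈ D, a ≤ b := by
    intro b
    by_cases hb : b ∈ D
    · exact ⟨b, hb, le_rfl⟩
    · obtain ⟨w, hw⟩ := not_not.mp hb
      exact ⟨w, mem_of_covBy hw, hw.le⟩
  obtain ⟨b⟩ := ‹Nonempty β›
  obtain ⟨a, ha, -⟩ := exists_mem_le b
  have : ∃ c ∈ D, c ≠ a := by
    by_cases hmin : IsMin a
    · have hna := h a
      push Not at hna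
      obtain ⟨hmax, hsucc⟩ := hna (Or.inl hmin)
      obtain ⟨c, hac⟩ := not_isMax_iff.mp hmax
      by_cases hc : c ∈ D
      · exact ⟨c, hc, hac.ne'⟩
      · obtain ⟨w, hw⟩ := not_not.mp hc
        exact ⟨w, mem_of_covBy hw, fun hwa ↦ hsucc c (hwa ▸ hw)⟩
    · obtain ⟨c, hca⟩ := not_isMin_iff.mp hmin
      obtain ⟨d, hd, hdc⟩ := exists_mem_le c
      exact ⟨d, hd, (hdc.trans_lt hca).ne⟩
  obtain ⟨c, hc, hca⟩ := this
  have : Nontrivial D := ⟨⟨⟨c, hc⟩, ⟨a, ha⟩, fun hne ↦ hca (congrArg Subtype.val hne)⟩⟩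
  have : DenselyOrdered D := ⟨fun x y hxy ↦
    let ⟨z, hz, hxz, hzy⟩ := dense y.2 hxy
    ⟨⟨z, hz⟩, hxz, hzy⟩⟩
  obtain ⟨e⟩ := Order.embedding_from_countable_to_dense ℚ D
  exact ⟨e.trans (OrderEmbedding.subtype (· ∈ D))⟩

/-- If the lower sets of a linear order contain a copy of the rationals, so does the order. -/
theorem nonempty_rat_orderEmbedding_of_lowerSet {α : Type*} [LinearOrder α]
    (e : ℚ ↪o LowerSet α) : Nonempty (ℚ ↪o α) := by
  have : Countable (ℚ ×ₗ Bool) := inferInstanceAs (Countable (ℚ × Bool))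
  obtain ⟨g⟩ := Order.embedding_from_countable_to_dense (ℚ ×ₗ Bool) ℚ
  have hlt : ∀ q : ℚ, e (g (toLex (q, false))) < e (g (toLex (q, true))) := fun q ↦
    e.strictMono (g.strictMono (Prod.Lex.toLex_lt_toLex.mpr (Or.inr ⟨rfl, Bool.false_lt_true⟩)))
  choose x hx hx' using fun q ↦ exists_of_ssubset (LowerSet.coe_ssubset_coe.mpr (hlt q))
  refine ⟨OrderEmbedding.ofStrictMono x fun p q hpq ↦ ?_⟩
  by_contra! hle
  have hpq' : e (g (toLex (p, true))) ≤ e (g (toLex (q, false))) :=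
    e.monotone (g.monotone (Prod.Lex.toLex_lt_toLex.mpr (Or.inl hpq)).le)
  exact hx' q (hpq' ((e (g (toLex (p, true)))).lower hle (hx p)))

/-- In an order-scattered linear order, every nonempty family of lower sets has a member
determined by finitely many memberships and non-memberships. -/
theorem exists_isolated_lowerSet {α : Type*} [LinearOrder α] (hα : ¬Nonempty (ℚ ↪o α))
    {T : Set (LowerSet α)} (hT : T.Nonempty) :
    ∃ A ∈ T, ∃ F G : Set α, F.Finite ∧ G.Finite ∧ (∀ x ∈ F, x ∈ A) ∧ (∀ x ∈ G, x ∉ A) ∧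
      ∀ B ∈ T, (∀ x ∈ F, x ∈ B) → (∀ x ∈ G, x ∉ B) → B = A := by
  have : Nonempty T := hT.to_subtype
  by_contra! hcon
  apply hα
  suffices Nonempty (ℚ ↪o T) by
    obtain ⟨e⟩ := this
    exact nonempty_rat_orderEmbedding_of_lowerSet (e.trans (OrderEmbedding.subtype (· ∈ T)))
  refine nonempty_rat_orderEmbedding_of_limit_points fun A ⟨hleft, hright⟩ ↦ ?_
  have hF : ∃ F : Set α, F.Finite ∧ (∀ x ∈ F, x ∈ A.1) ∧
      ∀ B : T, (∀ x ∈ F, x ∈ B.1) → A ≤ B := by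
    rcases hleft with hmin | ⟨P, hP⟩
    · exact ⟨∅, finite_empty, by simp, fun B _ ↦ hmin.isBot B⟩
    · obtain ⟨x, hxA, hxP⟩ := exists_of_ssubset (LowerSet.coe_ssubset_coe.mpr <| show P.1 < A.1 from hP.lt)
      refine ⟨{x}, finite_singleton x, by simpa using hxA, fun B hB ↦ ?_⟩
      by_contra! hBA
      exact hxP (hP.le_of_lt hBA (hB x rfl))
  have hG : ∃ G : Set α, G.Finite ∧ (∀ x ∈ G, x ∉ A.1) ∧
      ∀ B : T, (∀ x ∈ G, x ∉ B.1) → B ≤ A := by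
    rcases hright with hmax | ⟨S, hS⟩
    · exact ⟨∅, finite_empty, by simp, fun B _ ↦ hmax.isTop B⟩
    · obtain ⟨x, hxS, hxA⟩ := exists_of_ssubset (LowerSet.coe_ssubset_coe.mpr <| show A.1 < S.1 from hS.lt)
      refine ⟨{x}, finite_singleton x, by simpa using hxA, fun B hB ↦ ?_⟩
      by_contra! hAB
      exact hB x rfl (hS.ge_of_gt hAB hxS)
  obtain ⟨F, hFfin, hFA, hF⟩ := hF
  obtain ⟨G, hGfin, hGA, hG⟩ := hG
  obtain ⟨B, hBT, hBF, hBG, hBA⟩ := hcon A.1 A.2 F G hFfin hGfin hFA hGA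
  exact hBA (congrArg Subtype.val (le_antisymm (hG ⟨B, hBT⟩ hBG) (hF ⟨B, hBT⟩ hBF)))

/-- An order-convex set is determined by its lower and upper closures. -/
theorem Set.OrdConnected.eq_of_closures_eq {α : Type*} [Preorder α] {A B : Set α}
    (hA : A.OrdConnected) (hB : B.OrdConnected) (hl : lowerClosure A = lowerClosure B)
    (hu : upperClosure A = upperClosure B) : A = B := by
  rw [← hA.upperClosure_inter_lowerClosure, ← hB.upperClosure_inter_lowerClosure, hl, hu]

/-- If the order-convex subsets of a linear order contain a copy of the rationals, so does the
order. -/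
theorem nonempty_rat_orderEmbedding_of_ordConnected {α : Type*} [LinearOrder α]
    (e : ℚ ↪o {A : Set α // A.OrdConnected}) : Nonempty (ℚ ↪o α) := by
  have hl : Monotone fun q ↦ lowerClosure (e q).1 := fun p q hpq ↦
    lowerClosure_mono (e.monotone hpq)
  have hu : Antitone fun q ↦ upperClosure (e q).1 := fun p q hpq ↦
    upperClosure_anti (e.monotone hpq)
  by_cases hinj : StrictMono fun q ↦ lowerClosure (e q).1
  · exact nonempty_rat_orderEmbedding_of_lowerSet (OrderEmbedding.ofStrictMono _ hinj)
  simp only [StrictMono, not_forall] at hinj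
  obtain ⟨p, q, hpq, hnlt⟩ := hinj
  have hconst : lowerClosure (e p).1 = lowerClosure (e q).1 :=
    eq_of_le_of_not_lt (hl hpq.le) hnlt
  have heq : ∀ r ∈ Ioo p q, lowerClosure (e r).1 = lowerClosure (e p).1 := fun r hr ↦
    le_antisymm ((hl hr.2.le).trans_eq hconst.symm) (hl hr.1.le)
  have : Nontrivial (Ioo p q) := (Ioo_infinite hpq).nontrivial.coe_sort
  obtain ⟨g⟩ := Order.embedding_from_countable_to_dense ℚ (Ioo p q)
  refine nonempty_rat_orderEmbedding_of_lowerSet (OrderEmbedding.ofStrictMono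
    (fun r ↦ (upperClosure (e (g (-r))).1).compl) fun r s hrs ↦ ?_)
  have hlt : e (g (-s)) < e (g (-r)) := e.strictMono (g.strictMono (neg_lt_neg hrs))
  refine lt_of_le_of_ne (UpperSet.compl_le_compl.mpr (upperClosure_anti hlt.le)) fun h ↦ ?_
  refine hlt.ne (Subtype.ext ((e _).2.eq_of_closures_eq (e _).2 ?_ ?_))
  · rw [heq _ (g (-s)).2, heq _ (g (-r)).2]
  · have := congrArg LowerSet.compl h
    simpa using this.symm

theorem isOpen_cantorTop_setOf_mem {α : Type*} (x : α) :
    IsOpen[cantorTop α] {A : Set α | x ∈ A} := by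
  classical
  refine isOpen_induced_iff.mpr
    ⟨(fun f : α → Bool ↦ f x) ⁻¹' {true}, (isOpen_discrete _).preimage (continuous_apply x), ?_⟩
  ext A
  simp

theorem isOpen_cantorTop_setOf_notMem {α : Type*} (x : α) :
    IsOpen[cantorTop α] {A : Set α | x ∉ A} := by
  classical
  refine isOpen_induced_iff.mpr
    ⟨(fun f : α → Bool ↦ f x) ⁻¹' {false}, (isOpen_discrete _).preimage (continuous_apply x), ?_⟩
  ext A
  simp

/-- Open sets of the Cantor topology contain, around each of their points, a basic open set given
by finitely many coordinates. -/
theorem exists_finset_of_isOpen_cantorTop {α : Type*} {U : Set (Set α)}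
    (hU : IsOpen[cantorTop α] U) {A : Set α} (hA : A ∈ U) :
    ∃ I : Finset α, ∀ B : Set α, (∀ x ∈ I, x ∈ B ↔ x ∈ A) → B ∈ U := by
  classical
  obtain ⟨V, hV, rfl⟩ := isOpen_induced_iff.mp hU
  obtain ⟨I, u, hu, hsub⟩ := isOpen_pi_iff.mp hV _ hA
  refine ⟨I, fun B hB ↦ hsub fun x hx ↦ ?_⟩
  have := (hu x hx).2
  simp only [hB x hx]
  exact this

/-- The family of order-convex subsets of an order-scattered linear order is topologically
scattered. -/
theorem scatteredIn_ordConnected {α : Type*} [LinearOrder α] (hα : ¬Nonempty (ℚ ↪o α)) :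
    ScatteredIn (cantorTop α) {A : Set α | A.OrdConnected} := by
  intro T hTS hT
  have hTconv : ∀ {B : Set α}, B ∈ T → B.OrdConnected := fun hB ↦ hTS hB
  by_cases hne : ∃ A ∈ T, A.Nonempty
  swap
  · push Not at hne
    obtain ⟨A, hA⟩ := hT
    refine ⟨A, hA, univ, (cantorTop α).isOpen_univ, ?_⟩
    rw [inter_univ]
    exact eq_singleton_iff_unique_mem.mpr ⟨hA, fun B hB ↦ (hne B hB).trans (hne A hA).symm⟩
  obtain ⟨A₀, hA₀, x₀, hx₀⟩ := hne
  have mem_l : ∀ {B : Set α} {x : α}, B ∈ T → x₀ ∈ B →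
      (x ∈ lowerClosure B ↔ x ∈ B ∨ x ≤ x₀) := by
    intro B x hB hxB
    refine ⟨fun ⟨b, hb, hxb⟩ ↦ ?_, ?_⟩
    · rcases le_total x x₀ with h | h
      · exact Or.inr h
      · exact Or.inl ((hTconv hB).out hxB hb ⟨h, hxb⟩)
    · rintro (h | h)
      · exact subset_lowerClosure h
      · exact ⟨x₀, hxB, h⟩
  have mem_u : ∀ {B : Set α} {x : α}, B ∈ T → x₀ ∈ B →
      (x ∈ (upperClosure B).compl ↔ ¬(x ∈ B ∨ x₀ ≤ x)) := by
    intro B x hB hxB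
    rw [UpperSet.mem_compl_iff, not_iff_not]
    refine ⟨fun ⟨b, hb, hxb⟩ ↦ ?_, ?_⟩
    · rcases le_total x₀ x with h | h
      · exact Or.inr h
      · exact Or.inl ((hTconv hB).out hb hxB ⟨hxb, h⟩)
    · rintro (h | h)
      · exact subset_upperClosure h
      · exact ⟨x₀, hxB, h⟩
  obtain ⟨_, ⟨A₁, ⟨hA₁, hxA₁⟩, rfl⟩, F, G, hF, hG, hFA, hGA, hFG⟩ :=
    exists_isolated_lowerSet hα (T := lowerClosure '' {A | A ∈ T ∧ x₀ ∈ A})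
      ⟨_, A₀, ⟨hA₀, hx₀⟩, rfl⟩
  obtain ⟨_, ⟨A, ⟨hA, hxA, hAA₁⟩, rfl⟩, F', G', hF', hG', hFA', hGA', hFG'⟩ :=
    exists_isolated_lowerSet hα
      (T := (fun A : Set α ↦ (upperClosure A).compl) ''
        {A | A ∈ T ∧ x₀ ∈ A ∧ lowerClosure A = lowerClosure A₁})
      ⟨_, A₁, ⟨hA₁, hxA₁, rfl⟩, rfl⟩
  rw [← hAA₁] at hFA hGA hFG
  have hopen_or : ∀ (x : α) (P : Prop), IsOpen[cantorTop α] {B : Set α | x ∈ B ∨ P} := by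
    let := cantorTop α
    exact fun x P ↦ (isOpen_cantorTop_setOf_mem x).union isOpen_const
  refine ⟨A, hA, {B | x₀ ∈ B} ∩ ((⋂ x ∈ F, {B | x ∈ B ∨ x ≤ x₀}) ∩ (⋂ x ∈ G, {B | x ∉ B}) ∩
    ((⋂ x ∈ F', {B | x ∉ B}) ∩ ⋂ x ∈ G', {B | x ∈ B ∨ x₀ ≤ x})), ?_, ?_⟩
  · let := cantorTop α
    exact (isOpen_cantorTop_setOf_mem x₀).inter
      (((hF.isOpen_biInter fun x _ ↦ hopen_or x _).inter
        (hG.isOpen_biInter fun x _ ↦ isOpen_cantorTop_setOf_notMem x)).inter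
      ((hF'.isOpen_biInter fun x _ ↦ isOpen_cantorTop_setOf_notMem x).inter
        (hG'.isOpen_biInter fun x _ ↦ hopen_or x _)))
  · simp only [mem_l hA hxA, not_or] at hFA hGA
    simp only [mem_u hA hxA, not_or, not_and, not_not] at hFA' hGA'
    refine eq_singleton_iff_unique_mem.mpr ⟨⟨hA, ?_⟩, fun B ⟨hB, hBU⟩ ↦ ?_⟩
    · simp only [mem_inter_iff, mem_iInter, mem_ofPred_eq]
      exact ⟨hxA, ⟨hFA, fun x hx ↦ (hGA x hx).1⟩, fun x hx ↦ (hFA' x hx).1,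
        fun x hx ↦ or_iff_not_imp_left.mpr (by simpa using hGA' x hx)⟩
    · simp only [mem_inter_iff, mem_iInter, mem_ofPred_eq] at hBU
      obtain ⟨hxB, ⟨hBF, hBG⟩, hBF', hBG'⟩ := hBU
      have hl : lowerClosure B = lowerClosure A := by
        refine hFG _ ⟨B, ⟨hB, hxB⟩, rfl⟩ (fun x hx ↦ (mem_l hB hxB).mpr (hBF x hx)) fun x hx ↦ ?_
        rw [mem_l hB hxB, not_or]
        exact ⟨hBG x hx, (hGA x hx).2⟩
      have hu : (upperClosure B).compl = (upperClosure A).compl := by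
        refine hFG' _ ⟨B, ⟨hB, hxB, hl.trans hAA₁⟩, rfl⟩ (fun x hx ↦ ?_) fun x hx ↦ ?_
        · rw [mem_u hB hxB, not_or]
          exact ⟨hBF' x hx, (hFA' x hx).2⟩
        · rw [mem_u hB hxB, not_not]
          exact hBG' x hx
      exact (hTconv hB).eq_of_closures_eq (hTconv hA) hl
        (by simpa using congrArg LowerSet.compl hu)

/-- If the order-convex subsets of a linear order form a scattered space, the order contains no
copy of the rationals. -/
theorem not_nonempty_rat_orderEmbedding_of_scatteredIn {α : Type*} [LinearOrder α]
    (h : ScatteredIn (cantorTop α) {A : Set α | A.OrdConnected}) : ¬Nonempty (ℚ ↪o α) := by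
  rintro ⟨f⟩
  let A : ℚ → Set α := fun q ↦ lowerClosure (f '' Iio q)
  have mem_A : ∀ {q x}, x ∈ A q ↔ ∃ p < q, x ≤ f p := by
    intro q x
    simp [A]
  obtain ⟨_, ⟨q, rfl⟩, U, hU, hTU⟩ := h (range A)
    (by rintro _ ⟨q, rfl⟩; exact (lowerClosure _).lower.ordConnected) (range_nonempty A)
  have hqU : A q ∈ U := (hTU.symm.subset rfl).2
  obtain ⟨I, hI⟩ := exists_finset_of_isOpen_cantorTop hU hqU
  have hbound : ∃ p < q, ∀ x ∈ I, x ∈ A q → x ≤ f p := by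
    clear hI
    classical
    induction I using Finset.induction_on with
    | empty => exact ⟨q - 1, sub_one_lt q, by simp⟩
    | insert y I _ ih =>
      obtain ⟨p, hpq, hp⟩ := ih
      by_cases hy : y ∈ A q
      · obtain ⟨r, hrq, hyr⟩ := mem_A.mp hy
        refine ⟨max p r, max_lt hpq hrq, fun x hx hxq ↦ ?_⟩
        rcases Finset.mem_insert.mp hx with rfl | hx
        · exact hyr.trans (f.monotone (le_max_right p r))
        · exact (hp x hx hxq).trans (f.monotone (le_max_left p r))
      · refine ⟨p, hpq, fun x hx hxq ↦ ?_⟩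
        rcases Finset.mem_insert.mp hx with rfl | hx
        · exact absurd hxq hy
        · exact hp x hx hxq
  obtain ⟨p, hpq, hp⟩ := hbound
  obtain ⟨r, hpr, hrq⟩ := exists_between hpq
  have hrU : A r ∈ U := hI _ fun x hx ↦
    ⟨fun hxr ↦ let ⟨s, hs, hxs⟩ := mem_A.mp hxr; mem_A.mpr ⟨s, hs.trans hrq, hxs⟩,
      fun hxq ↦ mem_A.mpr ⟨p, hpr, hp x hx hxq⟩⟩
  have hAr : A r = A q := hTU.subset ⟨mem_range_self r, hrU⟩
  obtain ⟨s, hsr, hs⟩ := mem_A.mp (hAr ▸ mem_A.mpr ⟨r, hrq, le_rfl⟩ : f r ∈ A r)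
  exact (f.le_iff_le.mp hs).not_gt hsr

/-- A copy of the rationals in a linear order yields one in its poset of closed intervals. -/
theorem nonempty_rat_orderEmbedding_Icc {α : Type*} [LinearOrder α] (f : ℚ ↪o α) :
    Nonempty (ℚ ↪o {A : Set α // ∃ a b : α, a ≤ b ∧ A = Icc a b}) := by
  obtain ⟨g⟩ := Order.embedding_from_countable_to_dense ℚ (Ioi (0 : ℚ))
  have hle : ∀ q, f 0 ≤ f (g q) := fun q ↦ f.monotone (g q).2.le
  refine ⟨OrderEmbedding.ofMapLEIff (fun q ↦ ⟨Icc (f 0) (f (g q)), _, _, hle q, rfl⟩)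
    fun p q ↦ ?_⟩
  rw [Subtype.mk_le_mk, Icc_subset_Icc_iff (hle p)]
  simp

/-- For a linear order C, the following are equivalent:
Int(C) is topologically scattered; Int(C) is order-scattered; the poset of closed
intervals [a,b] is order-scattered; C is order-scattered. -/
theorem stmt_8 {α : Type*} [LinearOrder α] :
    List.TFAE
      [ ScatteredIn (cantorTop α) {A : Set α | A.OrdConnected},
        ¬ Nonempty (ℚ ↪o {A : Set α // A.OrdConnected}),
        ¬ Nonempty (ℚ ↪o {A : Set α // ∃ a b : α, a ≤ b ∧ A = Set.Icc a b}),
        ¬ Nonempty (ℚ ↪o α) ] := by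
  tfae_have 1 → 4 := not_nonempty_rat_orderEmbedding_of_scatteredIn
  tfae_have 4 → 1 := scatteredIn_ordConnected
  tfae_have 4 → 2 := fun h ⟨e⟩ ↦ h (nonempty_rat_orderEmbedding_of_ordConnected e)
  tfae_have 2 → 3 := by
    rintro h ⟨e⟩
    have hconv : ∀ A : Set α, (∃ a b : α, a ≤ b ∧ A = Icc a b) → A.OrdConnected := by
      rintro _ ⟨a, b, -, rfl⟩
      exact ordConnected_Icc
    exact h ⟨OrderEmbedding.ofMapLEIff (fun q ↦ ⟨(e q).1, hconv _ (e q).2⟩) fun p q ↦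
      e.le_iff_le⟩
  tfae_have 3 → 4 := fun h ⟨f⟩ ↦ h (nonempty_rat_orderEmbedding_Icc f)
  tfae_finish
end

section
/- Let φ be a finitary closure operator on a set X, i.e., φ(Y) = ⋃{φ(F) : F ⊆ Y finite} for all Y ⊆ X, and let L be the set of φ-closed subsets of X. If L, with the topology induced from the product topology on the power set of X, is a scattered topological space, then there is no order-embedding of ℚ into L ordered by inclusion. -/
/-- In a chain indexed by `ℚ`, a point of `⋃ p < r, A p` eventually lies in `A q` as `q` increases
to `r`. -/
theorem eventually_mem_of_mem_iUnion_lt {X : Type*} {A : ℚ → Set X} (hA : Monotone A) {r : ℚ}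
    {x : X} (hx : x ∈ ⋃ p < r, A p) : ∀ᶠ q in nhdsWithin r (Set.Iio r), x ∈ A q := by
  simp only [Set.mem_iUnion, exists_prop] at hx
  obtain ⟨p, hp, hx⟩ := hx
  filter_upwards [Ioo_mem_nhdsLT hp] with q hq using hA hq.1.le hx

/-- For a finitary closure operator, the union of an initial segment without maximum of a
`ℚ`-chain of closed sets is closed. -/
theorem closed_iUnion_lt {X : Type*} {φ : Set X → Set X}
    (hext : ∀ Y : Set X, Y ⊆ φ Y)
    (hmono : ∀ Y Z : Set X, Y ⊆ Z → φ Y ⊆ φ Z)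
    (hfin : ∀ Y : Set X, φ Y = ⋃ F ∈ {F : Set X | F ⊆ Y ∧ F.Finite}, φ F)
    {A : ℚ → Set X} (hA : Monotone A) (hclosed : ∀ q, φ (A q) = A q) (r : ℚ) :
    φ (⋃ p < r, A p) = ⋃ p < r, A p := by
  refine Set.Subset.antisymm (fun x hx => ?_) (hext _)
  rw [hfin] at hx
  simp only [Set.mem_iUnion, exists_prop, Set.mem_ofPred_eq] at hx
  obtain ⟨F, ⟨hFsub, hF⟩, hx⟩ := hx
  have hev : ∀ᶠ q in nhdsWithin r (Set.Iio r), ∀ y ∈ F, y ∈ A q :=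
    (Filter.eventually_all_finite hF).2 fun y hy => eventually_mem_of_mem_iUnion_lt hA (hFsub hy)
  obtain ⟨q, hq, hqr⟩ := (hev.and self_mem_nhdsWithin).exists
  exact Set.mem_biUnion hqr (hclosed q ▸ hmono F (A q) hq hx)

/-- A family of sets converges in the product topology if membership of each point is eventually
constant. -/
theorem eventually_mem_of_isOpen_cantorTop {X ι : Type*} {l : Filter ι} {B : ι → Set X}
    {C : Set X} (h : ∀ x, ∀ᶠ i in l, (x ∈ B i ↔ x ∈ C)) {U : Set (Set X)}
    (hU : (cantorTop X).IsOpen U) (hC : C ∈ U) : ∀ᶠ i in l, B i ∈ U := by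
  classical
  obtain ⟨V, hV, rfl⟩ := hU
  have ht : Filter.Tendsto (fun i (x : X) => decide (x ∈ B i)) l
      (nhds fun x => decide (x ∈ C)) := by
    refine tendsto_pi_nhds.2 fun x => tendsto_nhds_of_eventually_eq ?_
    filter_upwards [h x] with i hi
    simp [hi]
  have hCV : (fun x => decide (x ∈ C)) ∈ V := by
    convert Set.mem_preimage.1 hC
  filter_upwards [ht (IsOpen.mem_nhds hV hCV)] with i hi
  simp only [Set.mem_preimage] at hi ⊢
  convert hi

/-- If the lattice of closed sets of a finitary closure operator is
topologically scattered (in the product topology on the power set), then it is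
order-scattered. -/
theorem stmt_9 {X : Type*} (φ : Set X → Set X)
    (hext : ∀ Y : Set X, Y ⊆ φ Y)
    (hmono : ∀ Y Z : Set X, Y ⊆ Z → φ Y ⊆ φ Z)
    (hidem : ∀ Y : Set X, φ (φ Y) = φ Y)
    (hfin : ∀ Y : Set X, φ Y = ⋃ F ∈ {F : Set X | F ⊆ Y ∧ F.Finite}, φ F)
    (hscat : ScatteredIn (cantorTop X) {A : Set X | φ A = A}) :
    ¬ Nonempty (ℚ ↪o {A : Set X // φ A = A}) := by
  rintro ⟨f⟩
  let A : ℚ → Set X := fun q => (f q : Set X)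
  have hA : StrictMono A := fun p q hpq => f.strictMono hpq
  let B : ℚ → Set X := fun r => ⋃ p < r, A p
  have hBmono : StrictMono B := by
    intro r s hrs
    obtain ⟨p, hrp, hps⟩ := exists_between hrs
    obtain ⟨q, hpq, hqs⟩ := exists_between hps
    exact (Set.iUnion₂_subset fun t ht => hA.monotone (ht.trans hrp).le).trans_lt
      ((hA hpq).trans_le (Set.subset_biUnion_of_mem (u := A) hqs))
  have hconv : ∀ r x, ∀ᶠ q in nhdsWithin r (Set.Iio r), (x ∈ B q ↔ x ∈ B r) := by
    intro r x
    by_cases hx : x ∈ B r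
    · have hx' := hx
      simp only [B, Set.mem_iUnion, exists_prop] at hx'
      obtain ⟨p, hp, hxp⟩ := hx'
      filter_upwards [Ioo_mem_nhdsLT hp] with q hq
      exact iff_of_true (Set.mem_biUnion hq.1 hxp) hx
    · filter_upwards [self_mem_nhdsWithin] with q hq
      exact iff_of_false (fun h => hx (hBmono.monotone (le_of_lt hq) h)) hx
  obtain ⟨_, ⟨r, rfl⟩, U, hU, hTU⟩ := hscat (Set.range B)
    (Set.range_subset_iff.2 (closed_iUnion_lt hext hmono hfin hA.monotone fun q => (f q).2))
    (Set.range_nonempty B)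
  have hrU : B r ∈ U := (hTU.ge rfl).2
  obtain ⟨q, hqU, hqr⟩ :=
    ((eventually_mem_of_isOpen_cantorTop (hconv r) hU hrU).and self_mem_nhdsWithin).exists
  exact (hBmono hqr).ne (hTU.le ⟨⟨q, rfl⟩, hqU⟩)
end

section
/- Let n ∈ ℕ and let P_0, …, P_{n-1} be posets such that for each k there is no order-embedding of ℚ into P_k. Then there is no order-embedding of ℚ into the product poset P_0 × ⋯ × P_{n-1} (ordered componentwise). -/
/-- A monotone map from `ℚ` to an order-scattered poset takes the same value at two distinct
points of any nontrivial interval. -/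
theorem Monotone.exists_lt_and_eq_of_isEmpty_rat_orderEmbedding {α : Type*} [PartialOrder α]
    (hα : ¬ Nonempty (ℚ ↪o α)) {g : ℚ → α} (hg : Monotone g) {a b : ℚ} (hab : a < b) :
    ∃ c d, a ≤ c ∧ c < d ∧ d ≤ b ∧ g c = g d := by
  by_contra! H
  have : Nontrivial (Set.Ioo a b) := by
    obtain ⟨c, hac, hcb⟩ := exists_between hab
    obtain ⟨d, hcd, hdb⟩ := exists_between hcb
    exact ⟨⟨c, hac, hcb⟩, ⟨d, hac.trans hcd, hdb⟩, fun h ↦ hcd.ne (congrArg Subtype.val h)⟩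
  obtain ⟨e⟩ := Order.embedding_from_countable_to_dense ℚ (Set.Ioo a b)
  have hs : StrictMono fun q ↦ g (e q) := fun x y hxy ↦
    have hlt : (e x : ℚ) < e y := e.strictMono hxy
    (hg hlt.le).lt_of_ne (H _ _ (e x).2.1.le hlt (e y).2.2.le)
  exact hα ⟨OrderEmbedding.ofStrictMono _ hs⟩

/-- A finite product of order-scattered posets is order-scattered. -/
theorem stmt_10 {n : ℕ} (P : Fin n → Type*) [inst : ∀ k, PartialOrder (P k)]
    (h : ∀ k, ¬ Nonempty (ℚ ↪o P k)) :
    ¬ Nonempty (ℚ ↪o (∀ k, P k)) := by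
  rintro ⟨f⟩
  have hmono (k : Fin n) : Monotone fun q ↦ f q k := fun _ _ hxy ↦ f.monotone hxy k
  have key (s : Finset (Fin n)) : ∃ a b : ℚ, a < b ∧ ∀ k ∈ s, f a k = f b k := by
    induction s using Finset.induction_on with
    | empty => exact ⟨0, 1, zero_lt_one, by simp⟩
    | insert i s _ ih =>
      obtain ⟨a, b, hab, hs⟩ := ih
      obtain ⟨c, d, hac, hcd, hdb, hi⟩ :=
        (hmono i).exists_lt_and_eq_of_isEmpty_rat_orderEmbedding (h i) hab
      refine ⟨c, d, hcd, fun k hk ↦ ?_⟩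
      obtain rfl | hk := Finset.mem_insert.mp hk
      · exact hi
      · exact (hmono k hcd.le).antisymm
          ((hmono k hdb).trans ((hs k hk).symm.le.trans (hmono k hac)))
  obtain ⟨a, b, hab, heq⟩ := key Finset.univ
  exact hab.ne (f.injective (funext fun k ↦ heq k (Finset.mem_univ k)))
end

section
/- Let S be a meet-semilattice. The lattice Sub_∧(S) of all subsets of S closed under the meet operation, ordered by inclusion, admits an order-embedding of ℚ if and only if S is infinite. Equivalently, Sub_∧(S) is order-scattered if and only if S is finite. -/
theorem exists_injective_isChain_or_isAntichain_range (α : Type*) [PartialOrder α] [Infinite α] :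
    ∃ f : ℕ → α, Function.Injective f ∧
      (IsChain (· ≤ ·) (Set.range f) ∨ IsAntichain (· ≤ ·) (Set.range f)) := by
  have isChain_range (f : ℕ → α) (hf : Monotone f ∨ Antitone f) :
      IsChain (· ≤ ·) (Set.range f) := by
    rintro _ ⟨m, rfl⟩ _ ⟨n, rfl⟩ -
    rcases hf with hf | hf <;> rcases le_total m n with h | h
    exacts [Or.inl (hf h), Or.inr (hf h), Or.inr (hf h), Or.inl (hf h)]
  let f := Infinite.natEmbedding α
  obtain ⟨g, hg | hg⟩ := exists_increasing_or_nonincreasing_subseq (· < ·) f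
  · exact ⟨f ∘ g, f.injective.comp g.injective,
      Or.inl (isChain_range _ (Or.inl (StrictMono.monotone fun m n => hg m n)))⟩
  obtain ⟨h, hh | hh⟩ := exists_increasing_or_nonincreasing_subseq (· > ·) (f ∘ g)
  · exact ⟨(f ∘ g) ∘ h, (f.injective.comp g.injective).comp h.injective,
      Or.inl (isChain_range _ (Or.inr (StrictAnti.antitone fun m n => hh m n)))⟩
  refine ⟨(f ∘ g) ∘ h, (f.injective.comp g.injective).comp h.injective, Or.inr ?_⟩
  rintro _ ⟨m, rfl⟩ _ ⟨n, rfl⟩ hne hle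
  have hlt := lt_of_le_of_ne hle hne
  rcases lt_trichotomy m n with hmn | rfl | hmn
  · exact hg _ _ (h.strictMono hmn) hlt
  · exact hne rfl
  · exact hh _ _ hmn hlt

theorem inf_mem_of_subset_isChain {S : Type*} [SemilatticeInf S] {C T : Set S}
    (hC : IsChain (· ≤ ·) C) (hT : T ⊆ C) {x y : S} (hx : x ∈ T) (hy : y ∈ T) : x ⊓ y ∈ T := by
  rcases hC.total (hT hx) (hT hy) with h | h
  · rwa [inf_eq_left.2 h]
  · rwa [inf_eq_right.2 h]

/-- The powerset of `ℕ` embeds into the meet-subsemilattices of an infinite meet-semilattice. -/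
theorem nonempty_setNat_orderEmbedding_infClosed (S : Type*) [SemilatticeInf S] [Infinite S] :
    Nonempty (Set ℕ ↪o {T : Set S // ∀ x ∈ T, ∀ y ∈ T, x ⊓ y ∈ T}) := by
  obtain ⟨f, hf, hC | hA⟩ := exists_injective_isChain_or_isAntichain_range S
  · exact ⟨OrderEmbedding.ofMapLEIff
      (fun A => ⟨f '' A, fun x hx y hy =>
        inf_mem_of_subset_isChain hC (Set.image_subset_range f A) hx hy⟩)
      fun A B => Set.image_subset_image_iff hf⟩
  · refine ⟨OrderEmbedding.ofMapLEIff
      (fun A => ⟨{s | ∀ n, f n ≤ s → n ∈ A}, fun x hx y _ n hn => hx n (hn.trans inf_le_left)⟩)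
      fun A B => ⟨fun h n hn => ?_, fun h s hs n hns => h (hs n hns)⟩⟩
    refine h (fun m hm => ?_) n le_rfl
    rwa [hf (hA.eq ⟨m, rfl⟩ ⟨n, rfl⟩ hm)]

/-- For a meet-semilattice S, the lattice of meet-subsemilattices of S
(ordered by inclusion) admits an order-embedding of ℚ iff S is infinite. -/
theorem stmt_11 {S : Type*} [SemilatticeInf S] :
    Nonempty (ℚ ↪o {T : Set S // ∀ x ∈ T, ∀ y ∈ T, x ⊓ y ∈ T}) ↔ Infinite S := by
  refine ⟨fun ⟨e⟩ => ?_, fun _ => ?_⟩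
  · by_contra hS
    have : Finite S := not_infinite_iff_finite.1 hS
    exact not_finite_iff_infinite.2 inferInstance (Finite.of_injective e e.injective)
  · obtain ⟨F⟩ := nonempty_setNat_orderEmbedding_infClosed S
    let c := Denumerable.eqv ℚ
    let ι : ℚ ↪o Set ℕ := OrderEmbedding.ofMapLEIff (fun q => c '' Set.Iic q) fun p q =>
      (Set.image_subset_image_iff c.injective).trans Set.Iic_subset_Iic
    exact ⟨ι.trans F⟩
end

section
/- Let P be a partially ordered set, let S(P) = {(p, q) : p < q} be its strict order relation, and let O(P) be the set of all transitive subsets R of S(P) (i.e., (p, q) ∈ R and (q, r) ∈ R imply (p, r) ∈ R), ordered by inclusion. Then O(P) admits an order-embedding of ℚ if and only if S(P) is infinite. Equivalently, O(P) is order-scattered if and only if S(P) is finite. -/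
/-- If the strict order of `P` is infinite, it contains an infinite family of pairs no two of which
are composable. -/
theorem exists_injective_noncomposable_of_infinite_lt {P : Type*} [PartialOrder P]
    (h : {pq : P × P | pq.1 < pq.2}.Infinite) :
    ∃ e : ℕ → P × P, Function.Injective e ∧ (∀ n, (e n).1 < (e n).2) ∧
      ∀ m n, (e m).2 ≠ (e n).1 := by
  let f : ℕ → P × P := fun n => h.natEmbedding _ n
  have hf : Function.Injective f := Subtype.val_injective.comp (h.natEmbedding _).injective
  have hlt : ∀ n, (f n).1 < (f n).2 := fun n => (h.natEmbedding _ n).2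
  obtain ⟨g, hg | hg⟩ := exists_increasing_or_nonincreasing_subseq' (fun a b => a.2 = b.1) f
  · have hmono : StrictMono fun n => (f (g n)).1 :=
      strictMono_nat_of_lt_succ fun n => (hlt (g n)).trans_eq (hg n)
    refine ⟨fun n => ((f (g 0)).1, (f (g (n + 1))).1), fun m n hmn => ?_,
      fun n => hmono n.succ_pos, fun m n => (hmono m.succ_pos).ne'⟩
    simpa using hmono.injective (Prod.ext_iff.1 hmn).2
  obtain ⟨k, hk | hk⟩ :=
    exists_increasing_or_nonincreasing_subseq' (fun a b => b.2 = a.1) (f ∘ g)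
  · have hanti : StrictAnti fun n => (f (g (k n))).2 :=
      strictAnti_nat_of_succ_lt fun n => (hk n).trans_lt (hlt (g (k n)))
    refine ⟨fun n => ((f (g (k (n + 1)))).2, (f (g (k 0))).2), fun m n hmn => ?_,
      fun n => hanti n.succ_pos, fun m n => (hanti n.succ_pos).ne'⟩
    simpa using hanti.injective (Prod.ext_iff.1 hmn).1
  · refine ⟨fun n => f (g (k n)), hf.comp (g.injective.comp k.injective), fun n => hlt _,
      fun m n => ?_⟩
    rcases lt_trichotomy m n with hmn | rfl | hmn
    · exact hg _ _ (k.strictMono hmn)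
    · exact (hlt _).ne'
    · exact hk _ _ hmn

/-- For a poset P, the lattice O(P) of transitive subsets of the strict
order S(P) = {(p,q) : p < q} (ordered by inclusion) admits an order-embedding of ℚ
iff S(P) is infinite. -/
theorem stmt_12 {P : Type*} [PartialOrder P] :
    Nonempty (ℚ ↪o {R : Set (P × P) // R ⊆ {pq : P × P | pq.1 < pq.2} ∧
      ∀ p q r : P, (p, q) ∈ R → (q, r) ∈ R → (p, r) ∈ R})
    ↔ {pq : P × P | pq.1 < pq.2}.Infinite := by
  constructor
  · rintro ⟨φ⟩ hfin
    refine Set.infinite_range_of_injective (Subtype.val_injective.comp φ.injective)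
      (hfin.finite_subsets.subset ?_)
    rintro _ ⟨x, rfl⟩
    exact (φ x).2.1
  · intro h
    obtain ⟨e, he, hlt, hne⟩ := exists_injective_noncomposable_of_infinite_lt h
    let c : ℚ → P × P := e ∘ Denumerable.eqv ℚ
    have hc : Function.Injective c := he.comp (Denumerable.eqv ℚ).injective
    refine ⟨OrderEmbedding.ofMapLEIff (fun x => ⟨c '' Set.Iio x, ?_, ?_⟩) fun x y => ?_⟩
    · rintro _ ⟨y, -, rfl⟩
      exact hlt _
    · rintro p q r ⟨a, -, ha⟩ ⟨b, -, hb⟩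
      exact absurd ((congrArg Prod.snd ha).trans (congrArg Prod.fst hb).symm) (hne _ _)
    · exact (Set.image_subset_image_iff hc).trans Set.Iio_subset_Iio_iff
end

section
/- Let L be a complete lattice and κ a cardinal. Then the following are equivalent: (a) there exist an index set I of cardinality at most κ, complete linear orders C_i for i ∈ I, and an injective map f from L into the product Π_{i∈I} C_i such that f(sup S) = sup f(S) for every subset S of L; (b) L has a meet-dense subset A (every element of L is the infimum of some subset of A) that can be written as a union of at most κ chains of L. -/
/-- A map between complete lattices that preserves arbitrary suprema has an upper adjoint. -/
theorem galoisConnection_of_map_sSup {α β : Type*} [CompleteLattice α] [CompleteLattice β]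
    (f : α → β) (hf : ∀ S : Set α, f (sSup S) = sSup (f '' S)) :
    GaloisConnection f fun b => sSup {a | f a ≤ b} := by
  have hmono : Monotone f := fun x y hxy => by
    have h := hf {x, y}
    rw [sSup_pair, sup_eq_right.2 hxy] at h
    rw [h]
    exact le_sSup (Set.mem_image_of_mem f (Set.mem_insert x _))
  intro a b
  refine ⟨fun h => le_sSup h, fun h => (hmono h).trans ?_⟩
  rw [hf]
  exact sSup_le fun _ ⟨_, hx, hxy⟩ => hxy ▸ hx

/-- The ranges of the upper adjoints of the components of an injective supremum-preserving map
into a product are jointly meet-dense. -/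
theorem exists_subset_eq_sInf_of_injective {L I : Type*} [CompleteLattice L] {C : I → Type*}
    [∀ i, CompleteLattice (C i)] {f : L → ∀ i, C i} (hinj : Function.Injective f)
    (hf : ∀ S : Set L, f (sSup S) = sSup (f '' S)) {g : ∀ i, C i → L}
    (hg : ∀ i, GaloisConnection (fun x => f x i) (g i)) (x : L) :
    ∃ B ⊆ ⋃ i, Set.range (g i), x = sInf B := by
  refine ⟨Set.range fun i => g i (f x i), ?_, le_antisymm ?_ ?_⟩
  · rintro _ ⟨i, rfl⟩
    exact Set.mem_iUnion.2 ⟨i, Set.mem_range_self _⟩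
  · refine le_sInf ?_
    rintro _ ⟨i, rfl⟩
    exact (hg i).le_u_l x
  · have hle : f (sInf (Set.range fun i => g i (f x i))) ≤ f x := fun i =>
      (hg i).l_le (sInf_le (Set.mem_range_self i))
    refine sup_eq_right.1 (hinj ?_)
    rw [← sSup_pair, hf, Set.image_pair, sSup_pair, sup_eq_right.2 hle]

/-- The elements of `s` above `x`, as an upper set of `s`. -/
def upperSetAbove {L : Type*} [Preorder L] (s : Set L) (x : L) : UpperSet s where
  carrier := {a | x ≤ a}
  upper' _ _ hab ha := le_trans ha hab

theorem upperSetAbove_sSup {L : Type*} [CompleteLattice L] (s S : Set L) :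
    upperSetAbove s (sSup S) = sSup (upperSetAbove s '' S) := by
  ext a
  rw [SetLike.mem_coe, SetLike.mem_coe, UpperSet.mem_sSup_iff, Set.forall_mem_image]
  exact sSup_le_iff

/-- The complete linear order of upper sets of a chain, extending the lattice of upper sets. -/
noncomputable abbrev IsChain.completeLinearOrderUpperSet {L : Type*} [PartialOrder L] {s : Set L}
    (hs : IsChain (· ≤ ·) s) : CompleteLinearOrder (UpperSet s) := by
  classical
  exact @UpperSet.instCompleteLinearOrder s hs.linearOrder

/-- A complete lattice L embeds, by an injective map preserving
arbitrary suprema, into a product of at most κ complete linear orders iff L has a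
meet-dense subset which is a union of at most κ chains. -/
theorem stmt_13 {L : Type u} [CompleteLattice L] (κ : Cardinal.{u}) :
    (∃ (I : Type u) (C : I → Type u) (inst : ∀ i, CompleteLinearOrder (C i)),
      Cardinal.mk I ≤ κ ∧
      (letI := inst;
       ∃ f : L → ∀ i, C i, Function.Injective f ∧
         ∀ S : Set L, f (sSup S) = sSup (f '' S)))
    ↔
    (∃ A : Set L, (∀ x : L, ∃ B ⊆ A, x = sInf B) ∧
      ∃ (J : Type u) (c : J → Set L), Cardinal.mk J ≤ κ ∧
        (∀ j, IsChain (· ≤ ·) (c j)) ∧ A = ⋃ j, c j) := by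
  constructor
  · rintro ⟨I, C, inst, hI, f, hinj, hf⟩
    have hg (i : I) := galoisConnection_of_map_sSup (fun x => f x i) fun S => by
      rw [hf, sSup_apply_eq_sSup_image, Set.image_image]
    exact ⟨_, exists_subset_eq_sInf_of_injective hinj hf hg, I, _, hI,
      fun i => (hg i).monotone_u.isChain_range, rfl⟩
  · rintro ⟨_, hA, J, c, hJ, hc, rfl⟩
    refine ⟨J, fun j => UpperSet (c j), fun j => (hc j).completeLinearOrderUpperSet, hJ,
      fun x j => upperSetAbove (c j) x, fun x y hxy => ?_, fun S => funext fun j => ?_⟩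
    · have key (x y : L) (h : ∀ j, upperSetAbove (c j) x = upperSetAbove (c j) y) : x ≤ y := by
        obtain ⟨B, hB, rfl⟩ := hA y
        refine le_sInf fun b hb => ?_
        obtain ⟨j, hj⟩ := Set.mem_iUnion.1 (hB hb)
        have hmem : (⟨b, hj⟩ : c j) ∈ upperSetAbove (c j) (sInf B) := sInf_le hb
        rw [← h j] at hmem
        exact hmem
      exact le_antisymm (key x y (congrFun hxy)) (key y x fun j => (congrFun hxy j).symm)
    · rw [sSup_apply_eq_sSup_image, Set.image_image]
      exact upperSetAbove_sSup (c j) S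
end

section
/- Let C_1 = (X_1, ≤_1) and C_2 = (X_2, ≤_2) be linear orders and f : X_1 → X_2 a bijection. In the product lattice C_1 × C_2 (componentwise order, with join taking the maximum in each coordinate), the join-subsemilattice generated by the set {(x, f(x)) : x ∈ X_1} (the smallest subset containing it and closed under binary joins) is exactly {(x', f(x'')) : x', x'' ∈ X_1, x'' ≤_1 x' and f(x') ≤_2 f(x'')}. -/
/-- For linear orders C₁, C₂ and a bijection f : C₁ → C₂, the
join-subsemilattice of C₁ × C₂ generated by the diagonal {(x, f x)} is exactly
{(x', f x'') : x'' ≤ x' and f x' ≤ f x''}. -/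
theorem stmt_16 {α β : Type*} [LinearOrder α] [LinearOrder β] (f : α → β)
    (hf : Function.Bijective f) :
    ⋂₀ {T : Set (α × β) | (∀ x : α, (x, f x) ∈ T) ∧ ∀ p ∈ T, ∀ q ∈ T, p ⊔ q ∈ T}
      = {p : α × β | ∃ x' x'' : α, p = (x', f x'') ∧ x'' ≤ x' ∧ f x' ≤ f x''} := by
  apply Set.Subset.antisymm
  · apply Set.sInter_subset_of_mem
    refine ⟨fun x => ⟨x, x, rfl, le_rfl, le_rfl⟩, ?_⟩
    rintro _ ⟨a, b, rfl, hba, hab⟩ _ ⟨c, d, rfl, hdc, hcd⟩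
    simp only [Set.mem_ofPred_eq, Prod.mk_sup_mk]
    rcases le_total a c with hac | hac <;> rcases le_total (f b) (f d) with hbd | hbd <;>
      simp only [sup_of_le_left, sup_of_le_right, hac, hbd]
    · exact ⟨c, d, rfl, hdc, hcd⟩
    · exact ⟨c, b, rfl, hba.trans hac, hcd.trans hbd⟩
    · exact ⟨a, d, rfl, hdc.trans hac, hab.trans hbd⟩
    · exact ⟨a, b, rfl, hba, hab⟩
  · rintro _ ⟨a, b, rfl, hba, hab⟩ T ⟨hT, hsup⟩
    simpa [hba, hab] using hsup _ (hT a) _ (hT b)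
end

section
/- Let P be a join-semilattice with a least element whose join-dimension is a finite number n, i.e., n is the least natural number such that there is an injective join-preserving map of P into a product of n linear orders. Then the following are equivalent: (i) there is an injective join-preserving map of P into a product of n linear orders each of which is order-scattered; (ii) there is an injective join-preserving map of P into a product of finitely many order-scattered linear orders; (iii) Id P (the set of ideals of P ordered by inclusion), with the topology induced from the product topology on the power set of P, is a scattered topological space; (iv) Id P is order-scattered; (v) the set of completely meet-irreducible elements of the lattice Id P is order-scattered. -/
universe u

/-- A nonempty linear order in which no element is isolated in the order topology contains a copy
of the rationals. -/
lemma nonempty_rat_orderEmbedding_of_no_isolated {A : Type*} [LinearOrder A] [Nonempty A]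
    (h : ∀ y : A, ¬ ((IsBot y ∨ ∃ x, x ⋖ y) ∧ (IsTop y ∨ ∃ z, y ⋖ z))) :
    Nonempty (ℚ ↪o A) := by
  let D : Set A := {y | ¬ ∃ x, x ⋖ y}
  have cov : ∀ w z : A, w ⋖ z → w ∈ D := fun w z hwz hw => h w ⟨Or.inr hw, Or.inr ⟨z, hwz⟩⟩
  have exCov : ∀ z, z ∉ D → ∃ w, w ⋖ z := fun z hz => not_not.1 hz
  have key : ∀ x y : A, y ∈ D → x < y → ∃ z, x < z ∧ z < y := by
    intro x y hy hxy
    by_contra hcon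
    push Not at hcon
    exact hy ⟨x, hxy, fun z hz hzy => (hcon z hz).not_gt hzy⟩
  have hdense : DenselyOrdered D := by
    refine ⟨fun x y hxy => ?_⟩
    obtain ⟨x, hx⟩ := x
    obtain ⟨y, hy⟩ := y
    have hxy : x < y := hxy
    obtain ⟨z, hxz, hzy⟩ := key x y hy hxy
    by_cases hz : z ∈ D
    · exact ⟨⟨z, hz⟩, hxz, hzy⟩
    obtain ⟨z', hzz', hz'y⟩ := key z y hy hzy
    by_cases hz' : z' ∈ D
    · exact ⟨⟨z', hz'⟩, hxz.trans hzz', hz'y⟩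
    obtain ⟨w, hw⟩ := exCov z' hz'
    exact ⟨⟨w, cov w z' hw⟩, hxz.trans_le (hw.le_of_lt hzz'), hw.lt.trans hz'y⟩
  have hnontriv : Nontrivial D := by
    obtain ⟨t, ht⟩ : ∃ t, t ∈ D := by
      obtain ⟨a⟩ := ‹Nonempty A›
      by_cases ha : a ∈ D
      · exact ⟨a, ha⟩
      · obtain ⟨w, hw⟩ := exCov a ha
        exact ⟨w, cov w a hw⟩
    suffices H : ∃ s ∈ D, s ≠ t by
      obtain ⟨s, hs, hst⟩ := H
      exact ⟨⟨s, hs⟩, ⟨t, ht⟩, fun he => hst (congrArg Subtype.val he)⟩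
    by_cases hb : IsBot t
    · have hnt : ¬ (IsTop t ∨ ∃ z, t ⋖ z) := fun h' => h t ⟨Or.inl hb, h'⟩
      rw [not_or, not_exists] at hnt
      obtain ⟨s, hs⟩ : ∃ s, t < s := by simpa [IsTop] using hnt.1
      by_cases hsD : s ∈ D
      · exact ⟨s, hsD, hs.ne'⟩
      · obtain ⟨w, hw⟩ := exCov s hsD
        exact ⟨w, cov w s hw, fun he => hnt.2 s (he ▸ hw)⟩
    · obtain ⟨s, hs⟩ : ∃ s, s < t := by simpa [IsBot] using hb
      by_cases hsD : s ∈ D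
      · exact ⟨s, hsD, hs.ne⟩
      · obtain ⟨w, hw⟩ := exCov s hsD
        exact ⟨w, cov w s hw, (hw.lt.trans hs).ne⟩
  obtain ⟨e⟩ := Order.embedding_from_countable_to_dense ℚ D
  exact ⟨e.trans (OrderEmbedding.subtype _)⟩

/-- A chain of lower sets of order type `ℚ` yields a copy of the rationals in the base order. -/
lemma nonempty_rat_orderEmbedding_of_lowerSet_s17 {C : Type*} [LinearOrder C]
    (L : ℚ → LowerSet C) (hL : StrictMono L) : Nonempty (ℚ ↪o C) := by
  have : Countable (ℚ ×ₗ Bool) := ofLex.injective.countable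
  obtain ⟨e⟩ := Order.embedding_from_countable_to_dense (ℚ ×ₗ Bool) ℚ
  have hex : ∀ q : ℚ, ∃ c, c ∈ L (e (toLex (q, true))) ∧ c ∉ L (e (toLex (q, false))) := by
    intro q
    have hlt : e (toLex (q, false)) < e (toLex (q, true)) :=
      e.lt_iff_lt.2 (Prod.Lex.toLex_lt_toLex.2 (Or.inr ⟨rfl, Bool.false_lt_true⟩))
    exact Set.exists_of_ssubset (hL hlt)
  choose c hc hc' using hex
  have hmono : StrictMono c := by
    intro q r hqr
    have hlt : e (toLex (q, true)) < e (toLex (r, false)) :=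
      e.lt_iff_lt.2 (Prod.Lex.toLex_lt_toLex.2 (Or.inl hqr))
    by_contra hcon
    exact hc' r ((L _).lower (not_lt.1 hcon) ((hL hlt).le (hc q)))
  exact ⟨OrderEmbedding.ofStrictMono c hmono⟩

/-- The antitone two-valued functions on an order-scattered chain form a scattered space. -/
lemma scatteredIn_antitone {C : Type*} [LinearOrder C] (hC : ¬ Nonempty (ℚ ↪o C)) :
    ScatteredIn (inferInstance : TopologicalSpace (C → Bool)) {g | Antitone g} := by
  intro T hT hne
  let L : T → LowerSet C := fun g =>
    ⟨{c | g.1 c = true}, fun a b hba ha => by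
      have := hT g.2 hba
      simp only [Set.mem_ofPred_eq] at ha ⊢
      rw [ha] at this
      exact top_le_iff.1 this⟩
  have hLinj : Function.Injective L := by
    intro g g' hgg
    ext c
    have : c ∈ L g ↔ c ∈ L g' := by rw [hgg]
    exact Bool.eq_iff_iff.2 this
  have : Nonempty (Set.range L) := by
    obtain ⟨g, hg⟩ := hne
    exact ⟨⟨_, ⟨g, hg⟩, rfl⟩⟩
  have hiso : ∃ y : Set.range L, (IsBot y ∨ ∃ x, x ⋖ y) ∧ (IsTop y ∨ ∃ z, y ⋖ z) := by
    by_contra hcon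
    push Not at hcon
    obtain ⟨e⟩ := nonempty_rat_orderEmbedding_of_no_isolated (A := Set.range L)
      (fun y hy => by
        have := hcon y hy.1
        rcases hy.2 with h | ⟨z, hz⟩
        exacts [this.1 h, this.2 z hz])
    exact hC (nonempty_rat_orderEmbedding_of_lowerSet_s17 (fun q => (e q).1)
      fun q r hqr => e.lt_iff_lt.2 hqr)
  obtain ⟨⟨_, g, rfl⟩, hbot, htop⟩ := hiso
  have hopen : ∀ (c : C) (b : Bool), IsOpen {g : C → Bool | g c = b} := fun c b => by
    have hc : Continuous fun g : C → Bool => g c := continuous_apply c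
    exact (isOpen_discrete {b}).preimage hc
  have hU : ∃ U : Set (C → Bool), IsOpen U ∧ g.1 ∈ U ∧ ∀ g' : T, g'.1 ∈ U → L g ≤ L g' := by
    rcases hbot with hb | ⟨⟨x, hx⟩, hxg⟩
    · exact ⟨Set.univ, isOpen_univ, trivial, fun g' _ => hb ⟨L g', g', rfl⟩⟩
    · obtain ⟨c, hc, hc'⟩ := Set.exists_of_ssubset (show x < L g from hxg.lt)
      refine ⟨{g | g c = true}, hopen c true, hc, fun g' hg' => ?_⟩
      refine le_of_not_gt fun hlt => ?_
      have : (⟨L g', g', rfl⟩ : Set.range L) ≤ ⟨x, hx⟩ := hxg.le_of_lt hlt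
      exact hc' (this hg')
  have hV : ∃ V : Set (C → Bool), IsOpen V ∧ g.1 ∈ V ∧ ∀ g' : T, g'.1 ∈ V → L g' ≤ L g := by
    rcases htop with hb | ⟨⟨x, hx⟩, hxg⟩
    · exact ⟨Set.univ, isOpen_univ, trivial, fun g' _ => hb ⟨L g', g', rfl⟩⟩
    · obtain ⟨c, hc, hc'⟩ := Set.exists_of_ssubset (show L g < x from hxg.lt)
      refine ⟨{g | g c = false}, hopen c false, Bool.eq_false_iff.2 hc', fun g' hg' => ?_⟩
      refine le_of_not_gt fun hlt => ?_
      have : (⟨x, hx⟩ : Set.range L) ≤ ⟨L g', g', rfl⟩ := hxg.ge_of_gt hlt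
      have h1 : g'.1 c = true := this hc
      have h2 : g'.1 c = false := hg'
      simp [h1] at h2
  obtain ⟨U, hUo, hgU, hU⟩ := hU
  obtain ⟨V, hVo, hgV, hV⟩ := hV
  refine ⟨g, g.2, U ∩ V, hUo.inter hVo, ?_⟩
  ext g'
  constructor
  · rintro ⟨hg'T, hg'U, hg'V⟩
    have := hLinj (le_antisymm (hV ⟨g', hg'T⟩ hg'V) (hU ⟨g', hg'T⟩ hg'U))
    exact congrArg Subtype.val this
  · rintro rfl
    exact ⟨g.2, hgU, hgV⟩

/-- A finite product of scattered subspaces is scattered. -/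
lemma ScatteredIn.pi {ι : Type*} [Finite ι] {X : ι → Type*} [t : ∀ i, TopologicalSpace (X i)]
    {S : ∀ i, Set (X i)} (hS : ∀ i, ScatteredIn (t i) (S i)) :
    ScatteredIn (inferInstance : TopologicalSpace (∀ i, X i)) (Set.pi Set.univ S) := by
  classical
  intro T hT hne
  have := Fintype.ofFinite ι
  have key : ∀ s : Finset ι, ∃ x ∈ T, ∃ U : Set (∀ i, X i), IsOpen U ∧ x ∈ U ∧
      ∀ y ∈ T, y ∈ U → ∀ i ∈ s, y i = x i := by
    intro s
    induction s using Finset.induction_on with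
    | empty =>
      obtain ⟨x, hx⟩ := hne
      exact ⟨x, hx, Set.univ, isOpen_univ, trivial, by simp⟩
    | insert i s _ ih =>
      obtain ⟨x, hxT, U, hUo, hxU, hU⟩ := ih
      obtain ⟨a, ⟨x', ⟨hx'T, hx'U⟩, hx'a⟩, V, hVo, hV⟩ := hS i ((fun y => y i) '' (T ∩ U))
        (by rintro _ ⟨y, ⟨hy, -⟩, rfl⟩; exact hT hy i trivial) ⟨_, x, ⟨hxT, hxU⟩, rfl⟩
      have haV : a ∈ V := (hV.ge rfl).2
      refine ⟨x', hx'T, U ∩ (fun y => y i) ⁻¹' V,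
        hUo.inter (IsOpen.preimage (continuous_apply i) hVo), ⟨hx'U, ?_⟩, ?_⟩
      · rw [← hx'a] at haV
        exact haV
      · rintro y hyT ⟨hyU, hyV⟩ j hj
        rcases Finset.mem_insert.1 hj with rfl | hj
        · have : y j ∈ ({a} : Set (X j)) := hV.le ⟨⟨y, ⟨hyT, hyU⟩, rfl⟩, hyV⟩
          exact (Set.mem_singleton_iff.1 this).trans hx'a.symm
        · rw [hU y hyT hyU j hj, hU x' hx'T hx'U j hj]
  obtain ⟨x, hxT, U, hUo, hxU, hU⟩ := key Finset.univ
  refine ⟨x, hxT, U, hUo, ?_⟩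
  ext y
  constructor
  · rintro ⟨hyT, hyU⟩
    exact funext fun i => hU y hyT hyU i (Finset.mem_univ i)
  · rintro rfl
    exact ⟨hxT, hxU⟩

/-- A continuous image of a compact scattered space in a Hausdorff space is scattered. -/
lemma ScatteredIn.image {X Y : Type*} [t : TopologicalSpace X] [T2Space X]
    [t' : TopologicalSpace Y] [T2Space Y] {K : Set X} (hK : ScatteredIn t K) (hc : IsCompact K)
    {f : X → Y} (hf : Continuous f) : ScatteredIn t' (f '' K) := by
  intro T hT hne
  obtain ⟨Z, -, hZ⟩ := zorn_superset_nonempty {Z : Set X | Z ⊆ K ∧ IsClosed Z ∧ T ⊆ f '' Z}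
    (by
      intro c hc' hchain hcne
      refine ⟨⋂₀ c, ⟨?_, isClosed_sInter fun Z hZ => (hc' hZ).2.1, ?_⟩,
        fun s hs => Set.sInter_subset_of_mem hs⟩
      · obtain ⟨Z, hZ⟩ := hcne
        exact (Set.sInter_subset_of_mem hZ).trans (hc' hZ).1
      · intro y hy
        have : Nonempty c := hcne.to_subtype
        have hcl : ∀ Z : c, IsClosed (Z.1 ∩ f ⁻¹' {y}) := fun Z =>
          (hc' Z.2).2.1.inter (isClosed_singleton.preimage hf)
        obtain ⟨x, hx⟩ := IsCompact.nonempty_iInter_of_directed_nonempty_isCompact_isClosed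
          (fun Z : c => Z.1 ∩ f ⁻¹' {y})
          (by
            intro Z W
            rcases hchain.total Z.2 W.2 with h | h
            · exact ⟨Z, subset_rfl, Set.inter_subset_inter_left _ h⟩
            · exact ⟨W, Set.inter_subset_inter_left _ h, subset_rfl⟩)
          (by
            intro Z
            obtain ⟨x, hx, hxy⟩ := (hc' Z.2).2.2 hy
            exact ⟨x, hx, hxy⟩)
          (fun Z => hc.of_isClosed_subset (hcl Z) (Set.inter_subset_left.trans (hc' Z.2).1)) hcl
        rw [Set.mem_iInter] at hx
        exact ⟨x, fun Z hZ => (hx ⟨Z, hZ⟩).1, (hx (Classical.arbitrary c)).2⟩)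
    K ⟨subset_rfl, hc.isClosed, hT⟩
  obtain ⟨hZK, hZc, hTZ⟩ := hZ.prop
  obtain ⟨z, hz, U, hUo, hU⟩ := hK Z hZK (by
    obtain ⟨y, hy⟩ := hne
    obtain ⟨x, hx, -⟩ := hTZ hy
    exact ⟨x, hx⟩)
  have hUo : IsOpen U := hUo
  have hzU : z ∈ U := (hU.ge rfl).2
  have hcl : IsClosed (Z \ U) := hZc.sdiff hUo
  have hcl' : IsClosed (f '' (Z \ U)) :=
    ((hc.of_isClosed_subset hcl (Set.sdiff_subset.trans hZK)).image hf).isClosed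
  have hnot : ¬ T ⊆ f '' (Z \ U) := fun h =>
    (hZ.le_of_le ⟨Set.sdiff_subset.trans hZK, hcl, h⟩ Set.sdiff_subset hz).2 hzU
  have heq : ∀ y ∈ T, y ∉ f '' (Z \ U) → y = f z := by
    intro y hy hyn
    obtain ⟨x, hx, rfl⟩ := hTZ hy
    have hxU : x ∈ U := by
      by_contra hxU
      exact hyn ⟨x, ⟨hx, hxU⟩, rfl⟩
    rw [show x = z from hU.le ⟨hx, hxU⟩]
  obtain ⟨y, hy, hyn⟩ := Set.not_subset.1 hnot
  refine ⟨y, hy, (f '' (Z \ U))ᶜ, hcl'.isOpen_compl, ?_⟩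
  ext y'
  constructor
  · rintro ⟨hy', hyn'⟩
    exact (heq y' hy' hyn').trans (heq y hy hyn).symm
  · rintro rfl
    exact ⟨hy, hyn⟩

/-- Scatteredness of a family of sets can be checked on indicator functions. -/
lemma scatteredIn_cantorTop {α : Type*} {S : Set (Set α)} {S' : Set (α → Bool)}
    (hS' : ScatteredIn (inferInstance : TopologicalSpace (α → Bool)) S')
    (h : ∀ A ∈ S, ∃ g ∈ S', ∀ x, g x = true ↔ x ∈ A) : ScatteredIn (cantorTop α) S := by
  classical
  intro T hT hne
  let χ : Set α → α → Bool := fun A x => decide (x ∈ A)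
  have hχinj : Function.Injective χ := fun A B hAB => by
    ext x
    have := congrFun hAB x
    simpa [χ] using this
  obtain ⟨_, ⟨A, hA, rfl⟩, U, hUo, hU⟩ := hS' (χ '' T)
    (by
      rintro _ ⟨A, hA, rfl⟩
      obtain ⟨g, hg, hgA⟩ := h A (hT hA)
      convert hg using 1
      ext x
      simp [χ, ← hgA x]) (hne.image χ)
  refine ⟨A, hA, χ ⁻¹' U, ⟨U, hUo, ?_⟩, ?_⟩
  · congr!
  · ext B
    constructor
    · rintro ⟨hB, hBU⟩
      exact hχinj (hU.le ⟨⟨B, hB, rfl⟩, hBU⟩)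
    · rintro rfl
      exact ⟨hA, (hU.ge rfl).2⟩

/-- In a join-subsemilattice of a finite product of chains, an element lying in each coordinate
below some element of the ideal `J` belongs to `J`. -/
lemma mem_ideal_of_forall_exists_le {P : Type*} [SemilatticeSup P] [OrderBot P]
    {ι : Type*} [Finite ι] {C : ι → Type*} [∀ i, LinearOrder (C i)] {f : P → ∀ i, C i}
    (hinj : Function.Injective f) (hf : ∀ a b, f (a ⊔ b) = f a ⊔ f b) (J : Order.Ideal P) {x : P}
    (hx : ∀ i, ∃ a ∈ J, f x i ≤ f a i) : x ∈ J := by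
  have := Fintype.ofFinite ι
  have hmono : Monotone f := fun a b hab => by
    rw [← sup_eq_right.2 hab, hf]
    exact le_sup_left
  choose a ha hxa using hx
  have hle : f x ≤ f (Finset.univ.sup a) := fun i =>
    (hxa i).trans (hmono (Finset.le_sup (Finset.mem_univ i)) i)
  have hmem : Finset.univ.sup a ∈ J := (Order.Ideal.finsetSup_mem_iff J).2 fun i _ => ha i
  refine J.lower ?_ hmem
  rw [← sup_eq_right]
  exact hinj (by rw [hf, sup_eq_right.2 hle])

/-- The ideals of a join-subsemilattice of a finite product of order-scattered chains form a
scattered space. -/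
lemma scatteredIn_isIdeal {P : Type*} [SemilatticeSup P] [OrderBot P]
    {ι : Type*} [Finite ι] {C : ι → Type*} [∀ i, LinearOrder (C i)]
    (hC : ∀ i, ¬ Nonempty (ℚ ↪o C i)) {f : P → ∀ i, C i}
    (hinj : Function.Injective f) (hf : ∀ a b, f (a ⊔ b) = f a ⊔ f b) :
    ScatteredIn (cantorTop P) {A : Set P | Order.IsIdeal A} := by
  classical
  have := Fintype.ofFinite ι
  let Φ : (∀ i, C i → Bool) → P → Bool := fun g x => decide (∀ i, g i (f x i) = true)
  have hΦ : Continuous Φ := by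
    refine continuous_pi fun x => ?_
    have h1 : Continuous fun (b : ι → Bool) => decide (∀ i, b i = true) :=
      continuous_of_discreteTopology
    exact h1.comp (continuous_pi fun i => (continuous_apply (f x i)).comp (continuous_apply i))
  have hcomp : ∀ i, IsCompact {g : C i → Bool | Antitone g} := by
    intro i
    refine IsClosed.isCompact ?_
    simp only [Antitone, Set.ofPred_forall]
    refine isClosed_iInter fun a => isClosed_iInter fun b => isClosed_iInter fun _ => ?_
    have hp : Continuous fun g : C i → Bool => (g b, g a) :=
      (continuous_apply b).prodMk (continuous_apply a)
    exact (isClosed_discrete {p : Bool × Bool | p.1 ≤ p.2}).preimage hp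
  refine scatteredIn_cantorTop ((ScatteredIn.pi fun i => scatteredIn_antitone (hC i)).image
    (isCompact_univ_pi hcomp) hΦ) fun A hA => ?_
  have hA : Order.IsIdeal A := hA
  refine ⟨_, ⟨fun i c => decide (∃ a ∈ A, c ≤ f a i), fun i _ c d hcd => ?_, rfl⟩, fun x => ?_⟩
  · change decide _ → decide _
    simp only [decide_eq_true_eq]
    rintro ⟨a, ha, hda⟩
    exact ⟨a, ha, hcd.trans hda⟩
  · simp only [Φ, decide_eq_true_eq]
    exact ⟨fun h => mem_ideal_of_forall_exists_le hinj hf hA.toIdeal h, fun h i => ⟨x, h, le_rfl⟩⟩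

/-- If the space of ideals is scattered then it contains no copy of the rationals. -/
lemma not_nonempty_rat_orderEmbedding_ideal {P : Type*} [SemilatticeSup P] [OrderBot P]
    (h : ScatteredIn (cantorTop P) {A : Set P | Order.IsIdeal A}) :
    ¬ Nonempty (ℚ ↪o Order.Ideal P) := by
  classical
  rintro ⟨e⟩
  let K : ℚ → Set P := fun r => {x | ∃ q < r, x ∈ e q}
  have hKe : ∀ {q r}, q < r → (e q : Set P) ⊆ K r := fun hqr x hx => ⟨_, hqr, hx⟩
  have heK : ∀ r, K r ⊆ e r := fun r x ⟨q, hq, hx⟩ => e.monotone hq.le hx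
  have hKmono : Monotone K := fun r s hrs x ⟨q, hq, hx⟩ => ⟨q, hq.trans_le hrs, hx⟩
  have hne : ∀ {r s}, r < s → K r ≠ K s := by
    intro r s hrs heq
    obtain ⟨q, hrq, hqs⟩ := exists_between hrs
    have h1 : (e q : Set P) ⊆ e r := (hKe hqs).trans (heq ▸ heK r)
    exact (e.lt_iff_lt.2 hrq).not_ge h1
  have hKI : ∀ r, Order.IsIdeal (K r) := by
    intro r
    refine ⟨fun a b hba ⟨q, hq, ha⟩ => ⟨q, hq, (e q).lower hba ha⟩, ?_, ?_⟩
    · exact ⟨⊥, r - 1, by linarith, (e _).bot_mem⟩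
    · rintro a ⟨q, hq, ha⟩ b ⟨q', hq', hb⟩
      refine ⟨a ⊔ b, ⟨max q q', max_lt hq hq', Order.Ideal.sup_mem ?_ ?_⟩,
        le_sup_left, le_sup_right⟩
      · exact e.monotone (le_max_left _ _) ha
      · exact e.monotone (le_max_right _ _) hb
  obtain ⟨_, ⟨r, rfl⟩, _, ⟨U, hUo, rfl⟩, hU⟩ := h (Set.range K)
    (by rintro _ ⟨r, rfl⟩; exact hKI r) ⟨_, 0, rfl⟩
  have hr := (hU.ge rfl).2
  obtain ⟨I, u, hu, hIU⟩ := isOpen_pi_iff.1 hUo _ hr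
  have hq : ∃ q < r, ∀ x ∈ I, x ∈ K r → x ∈ e q := by
    clear hIU hu
    induction I using Finset.induction_on with
    | empty => exact ⟨r - 1, by linarith, by simp⟩
    | insert a I _ ih =>
      obtain ⟨q, hq, hqI⟩ := ih
      by_cases ha : a ∈ K r
      · obtain ⟨q', hq', haq'⟩ := ha
        refine ⟨max q q', max_lt hq hq', fun x hx hxr => ?_⟩
        rcases Finset.mem_insert.1 hx with rfl | hx
        · exact e.monotone (le_max_right _ _) haq'
        · exact e.monotone (le_max_left _ _) (hqI x hx hxr)
      · refine ⟨q, hq, fun x hx hxr => ?_⟩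
        rcases Finset.mem_insert.1 hx with rfl | hx
        · exact absurd hxr ha
        · exact hqI x hx hxr
  obtain ⟨q, hqr, hq⟩ := hq
  obtain ⟨s, hqs, hsr⟩ := exists_between hqr
  refine hne hsr (hU.le ⟨⟨s, rfl⟩, hIU fun x hx => ?_⟩)
  have hxx : x ∈ K s ↔ x ∈ K r := ⟨fun h => hKmono hsr.le h, fun h => hKe hqs (hq x hx h)⟩
  have := (hu x hx).2
  simp only [hxx]
  exact this

/-- Distinct elements are separated by completely meet-irreducible ideals. -/
lemma exists_completelyMeetIrreducible_ideal {P : Type*} [SemilatticeSup P] {x y : P}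
    (hxy : ¬ x ≤ y) :
    ∃ m : Order.Ideal P, (∀ S : Set (Order.Ideal P), IsGLB S m → m ∈ S) ∧ y ∈ m ∧ x ∉ m := by
  obtain ⟨m, -, hm⟩ := zorn_le_nonempty₀ {J : Order.Ideal P | y ∈ J ∧ x ∉ J}
    (by
      intro c hc hchain J hJ
      have hI : Order.IsIdeal (⋃₀ ((fun J : Order.Ideal P => (J : Set P)) '' c)) := by
        refine Order.isIdeal_sUnion_of_isChain ?_ ?_ ⟨_, J, hJ, rfl⟩
        · rintro _ ⟨J, -, rfl⟩
          exact J.isIdeal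
        · rintro _ ⟨J, hJ, rfl⟩ _ ⟨J', hJ', rfl⟩ _
          exact hchain.total hJ hJ'
      refine ⟨hI.toIdeal, ⟨⟨_, ⟨J, hJ, rfl⟩, (hc hJ).1⟩, ?_⟩, fun J' hJ' a ha =>
        ⟨_, ⟨J', hJ', rfl⟩, ha⟩⟩
      rintro ⟨_, ⟨J', hJ', rfl⟩, hx⟩
      exact (hc hJ').2 hx)
    (Order.Ideal.principal y) ⟨by simp, by simpa using hxy⟩
  refine ⟨m, fun S hS => ?_, hm.prop.1, hm.prop.2⟩
  have hs : ∃ s ∈ S, x ∉ s := by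
    by_contra hcon
    push Not at hcon
    have : Order.Ideal.principal x ≤ m :=
      hS.2 fun s hs => Order.Ideal.principal_le_iff.2 (hcon s hs)
    exact hm.prop.2 (Order.Ideal.principal_le_iff.1 this)
  obtain ⟨s, hsS, hxs⟩ := hs
  have hms : m ≤ s := hS.1 hsS
  rwa [le_antisymm hms (hm.le_of_ge ⟨hms hm.prop.1, hxs⟩ hms)]

/-- If the completely meet-irreducible ideals are order-scattered, a join-embedding into a product
of finitely many chains can be replaced by one into order-scattered chains. -/
lemma exists_scattered_of_completelyMeetIrreducible {P : Type u} [SemilatticeSup P] [OrderBot P]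
    {ι : Type*} [Finite ι] {C : ι → Type*} [∀ i, LinearOrder (C i)] {f : P → ∀ i, C i}
    (hinj : Function.Injective f) (hf : ∀ a b, f (a ⊔ b) = f a ⊔ f b)
    (h : ¬ Nonempty (ℚ ↪o {m : Order.Ideal P //
      ∀ S : Set (Order.Ideal P), IsGLB S m → m ∈ S})) :
    ∃ (D : ι → Type u) (inst : ∀ i, LinearOrder (D i)),
      letI := inst;
      (∀ i, ¬ Nonempty (ℚ ↪o D i)) ∧
      ∃ g : P → ∀ i, D i, Function.Injective g ∧ ∀ a b : P, g (a ⊔ b) = g a ⊔ g b := by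
  classical
  let M : ι → Type u := fun i => {m : Order.Ideal P //
    (∀ S : Set (Order.Ideal P), IsGLB S m → m ∈ S) ∧
      ∃ s : LowerSet (C i), ∀ x, x ∈ m ↔ f x i ∈ s}
  let instM : ∀ i, LinearOrder (M i) := fun i =>
    { (inferInstance : PartialOrder (M i)) with
      le_total := by
        rintro ⟨m, _, s, hs⟩ ⟨m', _, s', hs'⟩
        rcases le_total s s' with hss | hss
        · exact Or.inl fun x hx => (hs' x).2 (hss ((hs x).1 hx))
        · exact Or.inr fun x hx => (hs x).2 (hss ((hs' x).1 hx))
      toDecidableLE := Classical.decRel _ }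
  have hcover : ∀ m : Order.Ideal P, (∀ S : Set (Order.Ideal P), IsGLB S m → m ∈ S) →
      ∃ i, ∃ s : LowerSet (C i), ∀ x, x ∈ m ↔ f x i ∈ s := by
    intro m hm
    let s : ∀ i, LowerSet (C i) := fun i =>
      ⟨{c | ∃ a ∈ m, c ≤ f a i}, fun c d hdc ⟨a, ha, hca⟩ => ⟨a, ha, hdc.trans hca⟩⟩
    have hmono : Monotone f := fun a b hab => by
      rw [← sup_eq_right.2 hab, hf]
      exact le_sup_left
    have hJ : ∀ i, Order.IsIdeal {x | f x i ∈ s i} := by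
      intro i
      refine ⟨fun a b hba ha => (s i).lower (hmono hba i) ha,
        ⟨⊥, ⊥, m.bot_mem, le_rfl⟩, fun a ha b hb => ⟨a ⊔ b, ?_, le_sup_left, le_sup_right⟩⟩
      obtain ⟨a', ha', haa⟩ := ha
      obtain ⟨b', hb', hbb⟩ := hb
      refine ⟨a' ⊔ b', Order.Ideal.sup_mem ha' hb', ?_⟩
      rw [hf, hf]
      exact sup_le_sup haa hbb
    obtain ⟨i, hi⟩ := hm (Set.range fun i => (hJ i).toIdeal) ⟨by
        rintro _ ⟨i, rfl⟩ x hx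
        exact ⟨x, hx, le_rfl⟩, fun K hK x hx =>
          mem_ideal_of_forall_exists_le hinj hf m fun i => hK ⟨i, rfl⟩ hx⟩
    exact ⟨i, s i, fun x => by rw [← hi]; rfl⟩
  let g : P → ∀ i, LowerSet (M i) := fun x i =>
    ⟨{m | x ∉ m.1}, fun m m' hle hm hx => hm (hle hx)⟩
  refine ⟨fun i => LowerSet (M i), fun i => inferInstance, fun i => ?_, g, fun x y hxy => ?_, ?_⟩
  · rintro ⟨e⟩
    obtain ⟨e'⟩ := nonempty_rat_orderEmbedding_of_lowerSet_s17 e e.strictMono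
    exact h ⟨OrderEmbedding.ofStrictMono (fun q => ⟨(e' q).1, (e' q).2.1⟩)
      fun q r hqr => e'.strictMono hqr⟩
  · have key : ∀ x y : P, g x = g y → x ≤ y := by
      intro x y hxy
      by_contra hle
      obtain ⟨m, hm, hym, hxm⟩ := exists_completelyMeetIrreducible_ideal hle
      obtain ⟨i, hi⟩ := hcover m hm
      have hmem : (⟨m, hm, hi⟩ : M i) ∈ g x i := hxm
      rw [hxy] at hmem
      exact hmem hym
    exact le_antisymm (key x y hxy) (key y x hxy.symm)
  · intro a b
    funext i
    refine SetLike.ext fun m => ?_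
    have h1 : m ∈ g (a ⊔ b) i ↔ a ⊔ b ∉ m.1 := Iff.rfl
    have h2 : m ∈ (g a ⊔ g b) i ↔ m ∈ g a i ⊔ g b i := Iff.rfl
    have h3 : m ∈ g a i ⊔ g b i ↔ a ∉ m.1 ∨ b ∉ m.1 := LowerSet.mem_sup_iff
    rw [h1, h2, h3, Order.Ideal.sup_mem_iff, not_and_or]

/-- For a join-semilattice P with least element of finite
join-dimension n, the following are equivalent: P join-embeds into a product of n
order-scattered linear orders; P join-embeds into a product of finitely many
order-scattered linear orders; Id P is topologically scattered; Id P is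
order-scattered; the set of completely meet-irreducible elements of Id P is
order-scattered. -/
theorem stmt_17 {P : Type u} [SemilatticeSup P] [OrderBot P] (n : ℕ)
    (hdim_le : ∃ (C : Fin n → Type u) (inst : ∀ i, LinearOrder (C i)),
      letI := inst;
      ∃ f : P → ∀ i, C i, Function.Injective f ∧ ∀ a b : P, f (a ⊔ b) = f a ⊔ f b)
    (hdim_ge : ∀ m : ℕ, (∃ (C : Fin m → Type u) (inst : ∀ i, LinearOrder (C i)),
      letI := inst;
      ∃ f : P → ∀ i, C i, Function.Injective f ∧ ∀ a b : P, f (a ⊔ b) = f a ⊔ f b) →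
      n ≤ m) :
    List.TFAE
      [ (∃ (C : Fin n → Type u) (inst : ∀ i, LinearOrder (C i)),
          letI := inst;
          (∀ i, ¬ Nonempty (ℚ ↪o C i)) ∧
          ∃ f : P → ∀ i, C i, Function.Injective f ∧ ∀ a b : P, f (a ⊔ b) = f a ⊔ f b),
        (∃ (m : ℕ) (C : Fin m → Type u) (inst : ∀ i, LinearOrder (C i)),
          letI := inst;
          (∀ i, ¬ Nonempty (ℚ ↪o C i)) ∧
          ∃ f : P → ∀ i, C i, Function.Injective f ∧ ∀ a b : P, f (a ⊔ b) = f a ⊔ f b),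
        ScatteredIn (cantorTop P) {A : Set P | Order.IsIdeal A},
        ¬ Nonempty (ℚ ↪o Order.Ideal P),
        ¬ Nonempty (ℚ ↪o {m : Order.Ideal P //
          ∀ S : Set (Order.Ideal P), IsGLB S m → m ∈ S}) ] := by
  tfae_have 1 → 2 := fun ⟨C, inst, h⟩ => ⟨n, C, inst, h⟩
  tfae_have 2 → 3 := fun ⟨_, _, _, hC, _, hinj, hf⟩ => scatteredIn_isIdeal hC hinj hf
  tfae_have 3 → 4 := not_nonempty_rat_orderEmbedding_ideal
  tfae_have 4 → 5 := fun h ⟨e⟩ => h ⟨e.trans (OrderEmbedding.subtype _)⟩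
  tfae_have 5 → 1 := by
    obtain ⟨C, inst, f, hinj, hf⟩ := hdim_le
    exact exists_scattered_of_completelyMeetIrreducible hinj hf
  tfae_finish
end

section
/- Let P be a join-semilattice with a least element of finite join-dimension, i.e., for some n ∈ ℕ there is an injective join-preserving map of P into a product of n linear orders. Then ℚ order-embeds into Id P (the ideals of P ordered by inclusion) if and only if either ℚ order-embeds into P, or P contains a join-subsemilattice S for which there exist linear orders C_1, C_2 and an injective join-preserving map g : S → C_1 × C_2 (componentwise order, join = coordinatewise maximum) such that the first projection of g(S) is order-isomorphic to ℕ, ℚ order-embeds into the second projection of g(S), and for each element c of the first projection only finitely many elements of g(S) have first coordinate c. (The second alternative says exactly that the semilattice Ω(η) is a join-subsemilattice of P.) -/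
universe u

section JoinEmbedding

variable {P : Type u} [SemilatticeSup P]

/-- If `ℚ` embeds into the second projection of a join-subsemilattice of `P` inside a product
of two chains, then `ℚ` embeds into the ideals of `P`. -/
theorem nonempty_rat_embedding_ideal_of_snd {C₁ C₂ : Type*} [LinearOrder C₁] [LinearOrder C₂]
    (S : Set P) (hS : ∀ a ∈ S, ∀ b ∈ S, a ⊔ b ∈ S) (g : S → C₁ × C₂)
    (hg : ∀ (a : P) (ha : a ∈ S) (b : P) (hb : b ∈ S),
      g ⟨a ⊔ b, hS a ha b hb⟩ = g ⟨a, ha⟩ ⊔ g ⟨b, hb⟩)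
    (h : Nonempty (ℚ ↪o (Prod.snd '' Set.range g : Set C₂))) :
    Nonempty (ℚ ↪o Order.Ideal P) := by
  obtain ⟨φ⟩ := h
  have hattain : ∀ q, ∃ s : S, (g s).2 = (φ q : C₂) := fun q => by
    obtain ⟨_, ⟨s, rfl⟩, hs⟩ := (φ q).2
    exact ⟨s, hs⟩
  let I : ℚ → Order.Ideal P := fun q =>
    { carrier := {p | ∃ t : S, p ≤ t ∧ (g t).2 ≤ φ q}
      lower' := fun a b hba ⟨t, hat, ht⟩ => ⟨t, hba.trans hat, ht⟩
      nonempty' := by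
        obtain ⟨s, hs⟩ := hattain q
        exact ⟨s, s, le_rfl, hs.le⟩
      directed' := by
        rintro a ⟨t, hat, ht⟩ b ⟨t', hbt, ht'⟩
        refine ⟨t ⊔ t', ⟨⟨t ⊔ t', hS _ t.2 _ t'.2⟩, le_rfl, ?_⟩,
          hat.trans le_sup_left, hbt.trans le_sup_right⟩
        rw [hg _ t.2 _ t'.2]
        exact sup_le ht ht' }
  refine ⟨OrderEmbedding.ofMapLEIff I fun q r => ⟨fun hle => ?_, fun hqr => ?_⟩⟩
  · obtain ⟨s, hs⟩ := hattain q
    obtain ⟨t, hst, ht⟩ : (s : P) ∈ I r := hle ⟨s, le_rfl, hs.le⟩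
    have hsup := hg _ s.2 _ t.2
    have hst' : (⟨(s : P) ⊔ t, hS _ s.2 _ t.2⟩ : S) = t := Subtype.ext (sup_eq_right.2 hst)
    rw [hst'] at hsup
    have hle : (g s).2 ≤ (g t).2 := by
      have : g s ≤ g t := hsup ▸ le_sup_left
      exact this.2
    rw [← φ.le_iff_le, ← Subtype.coe_le_coe, ← hs]
    exact hle.trans ht
  · rintro p ⟨t, hpt, ht⟩
    exact ⟨t, hpt, ht.trans (φ.le_iff_le.2 hqr)⟩

/-- A monotone map from `ℚ` to a partial order is constant or strictly monotone on some copy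
of `ℚ`. -/
theorem exists_rat_embedding_const_or_strictMono {L : Type*} [PartialOrder L] (G : ℚ → L)
    (hG : Monotone G) :
    ∃ e : ℚ ↪o ℚ, (∀ q r, G (e q) = G (e r)) ∨ StrictMono (G ∘ e) := by
  by_cases h : ∃ a b, a < b ∧ G a = G b
  · obtain ⟨a, b, hab, hGab⟩ := h
    have : Nontrivial (Set.Ioo a b) := Set.nontrivial_coe_sort.2 (Set.Ioo_infinite hab).nontrivial
    obtain ⟨e⟩ := Order.embedding_from_countable_to_dense ℚ (Set.Ioo a b)
    have hc : ∀ q, G (e q) = G a := fun q =>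
      le_antisymm ((hG (e q).2.2.le).trans hGab.ge) (hG (e q).2.1.le)
    exact ⟨e.trans (OrderEmbedding.subtype _), Or.inl fun q r => (hc q).trans (hc r).symm⟩
  · push Not at h
    exact ⟨(OrderIso.refl ℚ).toOrderEmbedding, 
      Or.inr fun a b hab => (hG hab.le).lt_of_ne (h a b hab)⟩

theorem exists_rat_embedding_forall_const_or_strictMono {ι : Type*} {L : ι → Type*}
    [∀ i, PartialOrder (L i)] (G : ∀ i, ℚ → L i) (hG : ∀ i, Monotone (G i)) (s : Finset ι) :
    ∃ e : ℚ ↪o ℚ, ∀ i ∈ s, (∀ q r, G i (e q) = G i (e r)) ∨ StrictMono (G i ∘ e) := by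
  classical
  induction s using Finset.induction_on with
  | empty => exact ⟨(OrderIso.refl ℚ).toOrderEmbedding, by simp⟩
  | insert i s _ ih =>
    obtain ⟨e, he⟩ := ih
    obtain ⟨e', he'⟩ := exists_rat_embedding_const_or_strictMono (G i ∘ e)
      ((hG i).comp e.monotone)
    refine ⟨e'.trans e, fun k hk => ?_⟩
    rcases Finset.mem_insert.1 hk with rfl | hk
    · exact he'
    · exact (he k hk).imp (fun h q r => h _ _) fun h => h.comp e'.strictMono

variable {ι : Type*} {C : ι → Type u} [∀ i, LinearOrder (C i)] {f : P → ∀ i, C i}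

theorem le_of_injective_of_map_sup (hf : Function.Injective f)
    (hsup : ∀ a b, f (a ⊔ b) = f a ⊔ f b) {a b : P} (h : f a ≤ f b) : a ≤ b :=
  sup_eq_right.1 (hf ((hsup a b).trans (sup_eq_right.2 h)))

theorem monotone_of_map_sup (hsup : ∀ a b, f (a ⊔ b) = f a ⊔ f b) : Monotone f :=
  fun a b h => by rw [← sup_eq_right.2 h, hsup]; exact le_sup_left

/-- Finitely many conditions, each upward closed in one coordinate, that are separately attained
in an ideal are simultaneously attained there. -/
theorem exists_mem_ideal_forall [OrderBot P] [Fintype ι] (hf : Monotone f) (K : Order.Ideal P)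
    (Q : ∀ i, Set (C i)) (hQ : ∀ i, IsUpperSet (Q i)) (h : ∀ i, ∃ x ∈ K, f x i ∈ Q i) :
    ∃ x ∈ K, ∀ i, f x i ∈ Q i := by
  choose x hxK hxQ using h
  refine ⟨Finset.univ.sup x, ?_, fun i => hQ i (hf (Finset.le_sup (Finset.mem_univ i)) i) (hxQ i)⟩
  exact (Order.Ideal.finsetSup_mem_iff K).2 fun i _ => hxK i

/-- A sequence enumerated along `ℚ` whose coordinates in `A` increase with the index and whose
other coordinates increase with the rational generates the required join-subsemilattice. -/
theorem exists_joinSubsemilattice_of_sequence (hf : Function.Injective f)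
    (hsup : ∀ a b, f (a ⊔ b) = f a ⊔ f b) (A : Set ι) (e : ℕ ≃ ℚ) (y : ℕ → P)
    (hA : ∀ i ∈ A, Monotone fun n => f (y n) i)
    (hB : ∀ i ∉ A, ∀ m n, e m < e n → f (y m) i < f (y n) i)
    {i₀ j₀ : ι} (hi₀A : i₀ ∈ A) (hi₀ : StrictMono fun n => f (y n) i₀) (hj₀ : j₀ ∉ A) :
    ∃ S : Set P, ∃ hS : ∀ a ∈ S, ∀ b ∈ S, a ⊔ b ∈ S,
      ∃ (C₁ C₂ : Type u) (i₁ : LinearOrder C₁) (i₂ : LinearOrder C₂),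
        letI := i₁; letI := i₂;
        ∃ g : S → C₁ × C₂,
          Function.Injective g ∧
          (∀ (a : P) (ha : a ∈ S) (b : P) (hb : b ∈ S),
            g ⟨a ⊔ b, hS a ha b hb⟩ = g ⟨a, ha⟩ ⊔ g ⟨b, hb⟩) ∧
          Nonempty ((Prod.fst '' Set.range g : Set C₁) ≃o ℕ) ∧
          Nonempty (ℚ ↪o (Prod.snd '' Set.range g : Set C₂)) ∧
          (∀ c : C₁, {p : C₁ × C₂ | p ∈ Set.range g ∧ p.1 = c}.Finite) := by
  have hBm : ∀ i ∉ A, ∀ m n, e m ≤ e n → f (y m) i ≤ f (y n) i := fun i hi m n h => by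
    rcases h.lt_or_eq with h | h
    · exact (hB i hi m n h).le
    · rw [e.injective h]
  have hsA : ∀ i ∈ A, ∀ n m, m ≤ n → f (y n ⊔ y m) i = f (y n) i := fun i hi n m h => by
    rw [hsup]; exact sup_eq_left.2 (hA i hi h)
  have hsB : ∀ i ∉ A, ∀ n m, e n ≤ e m → f (y n ⊔ y m) i = f (y m) i := fun i hi n m h => by
    rw [hsup]; exact sup_eq_right.2 (hBm i hi _ _ h)
  let S : Set P := {s | ∃ n m, m ≤ n ∧ e n ≤ e m ∧ s = y n ⊔ y m}
  have hyS : ∀ n, y n ∈ S := fun n => ⟨n, n, le_rfl, le_rfl, sup_idem _ |>.symm⟩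
  have hS : ∀ a ∈ S, ∀ b ∈ S, a ⊔ b ∈ S := by
    rintro a ⟨n, m, hmn, hq, rfl⟩ b ⟨n', m', hmn', hq', rfl⟩
    obtain ⟨N, hN, hN', hNor⟩ : ∃ N, n ≤ N ∧ n' ≤ N ∧ (N = n ∨ N = n') := by
      rcases le_total n n' with h | h
      · exact ⟨n', h, le_rfl, Or.inr rfl⟩
      · exact ⟨n, le_rfl, h, Or.inl rfl⟩
    obtain ⟨M, hM, hM', hMor⟩ : ∃ M, e m ≤ e M ∧ e m' ≤ e M ∧ (M = m ∨ M = m') := by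
      rcases le_total (e m) (e m') with h | h
      · exact ⟨m', h, le_rfl, Or.inr rfl⟩
      · exact ⟨m, le_rfl, h, Or.inl rfl⟩
    have hMN : M ≤ N := by
      rcases hMor with rfl | rfl
      · exact hmn.trans hN
      · exact hmn'.trans hN'
    have hqNM : e N ≤ e M := by
      rcases hNor with rfl | rfl
      · exact hq.trans hM
      · exact hq'.trans hM'
    refine ⟨N, M, hMN, hqNM, le_antisymm ?_ ?_⟩
    · refine le_of_injective_of_map_sup hf hsup fun i => ?_
      rw [hsup]
      by_cases hi : i ∈ A
      · rw [Pi.sup_apply, hsA i hi _ _ hmn, hsA i hi _ _ hmn', hsA i hi _ _ hMN]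
        exact sup_le (hA i hi hN) (hA i hi hN')
      · rw [Pi.sup_apply, hsB i hi _ _ hq, hsB i hi _ _ hq', hsB i hi _ _ hqNM]
        exact sup_le (hBm i hi _ _ hM) (hBm i hi _ _ hM')
    · refine sup_le ?_ ?_
      · rcases hNor with rfl | rfl
        · exact le_sup_left.trans le_sup_left
        · exact le_sup_left.trans le_sup_right
      · rcases hMor with rfl | rfl
        · exact le_sup_right.trans le_sup_left
        · exact le_sup_right.trans le_sup_right
  have hinjB : ∀ m m', f (y m) j₀ = f (y m') j₀ → m = m' := fun m m' h => by
    rcases lt_trichotomy (e m) (e m') with h' | h' | h'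
    · exact absurd h (hB j₀ hj₀ _ _ h').ne
    · exact e.injective h'
    · exact absurd h (hB j₀ hj₀ _ _ h').ne'
  let g : S → C i₀ × C j₀ := fun s => (f s i₀, f s j₀)
  refine ⟨S, hS, C i₀, C j₀, inferInstance, inferInstance, g, ?_, ?_, ?_, ?_, ?_⟩
  · rintro ⟨_, n, m, hmn, hq, rfl⟩ ⟨_, n', m', hmn', hq', rfl⟩ h
    have h₁ : f (y n ⊔ y m) i₀ = f (y n' ⊔ y m') i₀ := congrArg Prod.fst h
    have h₂ : f (y n ⊔ y m) j₀ = f (y n' ⊔ y m') j₀ := congrArg Prod.snd h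
    rw [hsA _ hi₀A _ _ hmn, hsA _ hi₀A _ _ hmn'] at h₁
    rw [hsB _ hj₀ _ _ hq, hsB _ hj₀ _ _ hq'] at h₂
    obtain rfl := hi₀.injective h₁
    obtain rfl := hinjB _ _ h₂
    rfl
  · intro a _ b _
    simp only [g, hsup]
    rfl
  · have hrange : (Prod.fst '' Set.range g : Set (C i₀)) = Set.range fun n => f (y n) i₀ := by
      ext c
      constructor
      · rintro ⟨_, ⟨⟨_, n, m, hmn, -, rfl⟩, rfl⟩, rfl⟩
        exact ⟨n, (hsA _ hi₀A _ _ hmn).symm⟩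
      · rintro ⟨n, rfl⟩
        exact ⟨_, ⟨⟨y n, hyS n⟩, rfl⟩, rfl⟩
    exact ⟨(OrderIso.setCongr _ _ hrange).trans hi₀.orderIso.symm⟩
  · refine ⟨OrderEmbedding.ofStrictMono
      (fun q => ⟨f (y (e.symm q)) j₀, _, ⟨⟨_, hyS _⟩, rfl⟩, rfl⟩) fun q r h => ?_⟩
    exact hB j₀ hj₀ _ _ (by simpa using h)
  · intro c
    by_cases hc : ∃ n, f (y n) i₀ = c
    · obtain ⟨n, rfl⟩ := hc
      refine ((Set.finite_Iic n).image fun m => (f (y n) i₀, f (y m) j₀)).subset ?_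
      rintro _ ⟨⟨⟨_, n', m, hmn, hq, rfl⟩, rfl⟩, h⟩
      have h' : f (y n' ⊔ y m) i₀ = f (y n) i₀ := h
      rw [hsA _ hi₀A _ _ hmn] at h'
      obtain rfl := hi₀.injective h'
      exact ⟨m, hmn, Prod.ext (hsA _ hi₀A _ _ hmn).symm (hsB _ hj₀ _ _ hq).symm⟩
    · refine Set.finite_empty.subset ?_
      rintro _ ⟨⟨⟨_, n, m, hmn, hq, rfl⟩, rfl⟩, h⟩
      exact hc ⟨n, (hsA _ hi₀A _ _ hmn).symm.trans h⟩

/-- A `ℚ`-chain of ideals that agree cofinally in the coordinates in `A` and are separated by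
elements in all other coordinates yields either a copy of `ℚ` or a sequence enumerated along `ℚ`
whose coordinates in `A` increase with the index. -/
theorem nonempty_rat_embedding_or_exists_sequence [OrderBot P] [Fintype ι]
    (hf : Function.Injective f)
    (hsup : ∀ a b, f (a ⊔ b) = f a ⊔ f b) (A : Set ι) (J : ℚ → Order.Ideal P) (e : ℕ ≃ ℚ)
    (hA : ∀ i ∈ A, ∀ q r, ∀ z ∈ J q, ∃ x ∈ J r, f z i ≤ f x i)
    (hB : ∀ i ∉ A, ∀ r, ∃ x ∈ J r, ∀ q < r, ∀ z ∈ J q, f z i < f x i)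
    {j₀ : ι} (hj₀ : j₀ ∉ A) :
    Nonempty (ℚ ↪o P) ∨ ∃ i₀ ∈ A, ∃ y : ℕ → P, (StrictMono fun n => f (y n) i₀) ∧
      (∀ i ∈ A, Monotone fun n => f (y n) i) ∧
      ∀ i ∉ A, ∀ m n, e m < e n → f (y m) i < f (y n) i := by
  have hmono := monotone_of_map_sup hsup
  have hupB : ∀ (i : ι) (r : ℚ), IsUpperSet {c : C i | i ∉ A → ∀ q < r, ∀ z ∈ J q, f z i < c} :=
    fun i r c d hcd hc hi q hq z hz => (hc hi q hq z hz).trans_le hcd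
  by_cases hmax : ∀ i ∈ A, ∃ q, ∃ z ∈ J q, ∀ r, ∀ x ∈ J r, f x i ≤ f z i
  · left
    have hex : ∀ r, ∃ x ∈ J r, ∀ i, f x i ∈ {c : C i | (i ∈ A → ∀ q, ∀ z ∈ J q, f z i ≤ c) ∧
        (i ∉ A → ∀ q < r, ∀ z ∈ J q, f z i < c)} := fun r => by
      refine exists_mem_ideal_forall hmono (J r) _ (fun i => ?_) fun i => ?_
      · exact fun c d hcd hc =>
          ⟨fun hi q z hz => (hc.1 hi q z hz).trans hcd, hupB i r hcd hc.2⟩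
      · by_cases hi : i ∈ A
        · obtain ⟨q, z, hz, hzmax⟩ := hmax i hi
          obtain ⟨x, hx, hzx⟩ := hA i hi q r z hz
          exact ⟨x, hx, fun _ q z' hz' => (hzmax q z' hz').trans hzx, fun h => absurd hi h⟩
        · obtain ⟨x, hx, h⟩ := hB i hi r
          exact ⟨x, hx, fun h => absurd h hi, fun _ => h⟩
    choose x hxJ hx using hex
    have hlt : ∀ i ∉ A, ∀ q r, q < r → f (x q) i < f (x r) i := fun i hi q r h =>
      (hx r i).2 hi q h _ (hxJ q)
    refine ⟨OrderEmbedding.ofStrictMono x fun q r h => lt_of_le_of_ne ?_ fun heq => ?_⟩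
    · refine le_of_injective_of_map_sup hf hsup fun i => ?_
      by_cases hi : i ∈ A
      · exact (hx r i).1 hi q _ (hxJ q)
      · exact (hlt i hi q r h).le
    · exact (hlt j₀ hj₀ q r h).ne (by rw [heq])
  · right
    push Not at hmax
    obtain ⟨i₀, hi₀, hnomax⟩ := hmax
    have hstep : ∀ (z : {z : P // ∃ q, z ∈ J q}) (r : ℚ), ∃ x ∈ J r, ∀ i,
        f x i ∈ {c : C i | (i ∈ A → f z i ≤ c) ∧ (i = i₀ → f z i < c) ∧
          (i ∉ A → ∀ q < r, ∀ z ∈ J q, f z i < c)} := by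
      rintro ⟨z, q, hz⟩ r
      refine exists_mem_ideal_forall hmono (J r) _ (fun i => ?_) fun i => ?_
      · exact fun c d hcd hc =>
          ⟨fun hi => (hc.1 hi).trans hcd, fun hi => (hc.2.1 hi).trans_le hcd, hupB i r hcd hc.2.2⟩
      · by_cases hi : i ∈ A
        · by_cases h₀ : i = i₀
          · subst h₀
            obtain ⟨q', z', hz', hlt⟩ := hnomax q z hz
            obtain ⟨x, hx, hzx⟩ := hA i hi q' r z' hz'
            exact ⟨x, hx, fun _ => (hlt.trans_le hzx).le, fun _ => hlt.trans_le hzx,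
              fun h => absurd hi h⟩
          · obtain ⟨x, hx, hzx⟩ := hA i hi q r z hz
            exact ⟨x, hx, fun _ => hzx, fun h => absurd h h₀, fun h => absurd hi h⟩
        · obtain ⟨x, hx, h⟩ := hB i hi r
          exact ⟨x, hx, fun h => absurd h hi, fun h => absurd (h ▸ hi₀) hi, fun _ => h⟩
    choose x hxJ hx using hstep
    let y : ℕ → {z : P // ∃ q, z ∈ J q} := fun n =>
      Nat.rec (motive := fun _ => {z : P // ∃ q, z ∈ J q}) ⟨x ⟨⊥, 0, (J 0).bot_mem⟩ (e 0), _, hxJ _ _⟩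
        (fun n z => ⟨x z (e (n + 1)), _, hxJ _ _⟩) n
    have hy : ∀ n, ∃ z : {z : P // ∃ q, z ∈ J q}, (y n).1 = x z (e n) := fun n => by
      cases n with
      | zero => exact ⟨_, rfl⟩
      | succ n => exact ⟨_, rfl⟩
    refine ⟨i₀, hi₀, fun n => (y n).1, strictMono_nat_of_lt_succ fun n => ?_,
      fun i hi => monotone_nat_of_le_succ fun n => ?_, fun i hi m n h => ?_⟩
    · exact (hx (y n) (e (n + 1)) i₀).2.1 rfl
    · exact (hx (y n) (e (n + 1)) i).1 hi
    · obtain ⟨z, hz⟩ := hy n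
      obtain ⟨w, hw⟩ := hy m
      simp only [hz]
      exact (hx z (e n) i).2.2 hi (e m) h _ (hw ▸ hxJ w (e m))

/-- The lower set generated by the `i`-th coordinates of the elements of an ideal. -/
def coordinateLowerSet (f : P → ∀ i, C i) (i : ι) (I : Order.Ideal P) : LowerSet (C i) :=
  lowerClosure ((fun x => f x i) '' I)

theorem mem_coordinateLowerSet {i : ι} {I : Order.Ideal P} {c : C i} :
    c ∈ coordinateLowerSet f i I ↔ ∃ x ∈ I, c ≤ f x i := by
  simp [coordinateLowerSet, mem_lowerClosure]

theorem coordinateLowerSet_mono (i : ι) : Monotone (coordinateLowerSet f i) :=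
  fun _ _ h => lowerClosure_mono (Set.image_mono h)

theorem ideal_le_of_coordinateLowerSet_le [OrderBot P] [Fintype ι] (hf : Function.Injective f)
    (hsup : ∀ a b, f (a ⊔ b) = f a ⊔ f b) {I K : Order.Ideal P}
    (h : ∀ i, coordinateLowerSet f i I ≤ coordinateLowerSet f i K) : I ≤ K := by
  intro a ha
  obtain ⟨x, hx, hax⟩ := exists_mem_ideal_forall (monotone_of_map_sup hsup) K
    (fun i => Set.Ici (f a i)) (fun i => isUpperSet_Ici _) fun i =>
      mem_coordinateLowerSet.1 (h i (mem_coordinateLowerSet.2 ⟨a, ha, le_rfl⟩))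
  exact K.lower (le_of_injective_of_map_sup hf hsup hax) hx

/-- From a copy of `ℚ` among the ideals one extracts a `ℚ`-chain of ideals in which every
coordinate is either cofinally constant or strictly separated by elements. -/
theorem exists_rat_chain_of_ideals [OrderBot P] [Fintype ι] (hf : Function.Injective f)
    (hsup : ∀ a b, f (a ⊔ b) = f a ⊔ f b) (φ : ℚ ↪o Order.Ideal P) :
    ∃ (A : Set ι) (J : ℚ → Order.Ideal P) (j₀ : ι), j₀ ∉ A ∧
      (∀ i ∈ A, ∀ q r, ∀ z ∈ J q, ∃ x ∈ J r, f z i ≤ f x i) ∧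
      ∀ i ∉ A, ∀ r, ∃ x ∈ J r, ∀ q < r, ∀ z ∈ J q, f z i < f x i := by
  obtain ⟨e, he⟩ := exists_rat_embedding_forall_const_or_strictMono
    (fun i q => coordinateLowerSet f i (φ q))
    (fun i => (coordinateLowerSet_mono i).comp φ.monotone) Finset.univ
  have : Countable (ℚ ×ₗ Bool) := inferInstanceAs (Countable (ℚ × Bool))
  obtain ⟨d⟩ := Order.embedding_from_countable_to_dense (ℚ ×ₗ Bool) ℚ
  let A : Set ι := {i | ∀ q r, coordinateLowerSet f i (φ (e q)) = coordinateLowerSet f i (φ (e r))}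
  obtain ⟨j₀, hj₀⟩ : ∃ j, j ∉ A := by
    by_contra! hall
    have hle : φ (e 1) ≤ φ (e 0) :=
      ideal_le_of_coordinateLowerSet_le hf hsup fun i => (hall i 1 0).le
    rw [φ.le_iff_le, e.le_iff_le] at hle
    norm_num at hle
  refine ⟨A, fun q => φ (e (d (toLex (q, true)))), j₀, hj₀, fun i hi q r z hz => ?_,
    fun i hi r => ?_⟩
  · exact mem_coordinateLowerSet.1 (hi (d (toLex (q, true))) (d (toLex (r, true))) ▸
      mem_coordinateLowerSet.2 ⟨z, hz, le_rfl⟩)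
  · have hlt := ((he i (Finset.mem_univ i)).resolve_left hi)
      (d.strictMono (show toLex (r, false) < toLex (r, true) by simp [Prod.Lex.toLex_lt_toLex]))
    obtain ⟨c, hc, hc'⟩ := Set.exists_of_ssubset (LowerSet.coe_ssubset_coe.2 hlt)
    obtain ⟨x, hx, hcx⟩ := mem_coordinateLowerSet.1 hc
    refine ⟨x, hx, fun q hq z hz => lt_of_not_ge fun hxz => hc' ?_⟩
    refine mem_coordinateLowerSet.2 ⟨z, ?_, hcx.trans hxz⟩
    refine φ.monotone (e.monotone (d.monotone ?_)) hz
    exact (show toLex (q, true) < toLex (r, false) by simp [Prod.Lex.toLex_lt_toLex, hq]).le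

end JoinEmbedding

/-- For a join-semilattice P with least element of finite
join-dimension, ℚ order-embeds into Id P iff ℚ order-embeds into P or Ω(η) is a
join-subsemilattice of P, the latter spelled out as the existence of a
join-subsemilattice S of P admitting an injective join-preserving map g into a
product of two chains whose first projection has order type ω, whose second
projection is non-scattered, and with finite fibers over every first coordinate. -/
theorem stmt_18 {P : Type u} [SemilatticeSup P] [OrderBot P]
    (hdim : ∃ (n : ℕ) (C : Fin n → Type u) (inst : ∀ i, LinearOrder (C i)),
      letI := inst;
      ∃ f : P → ∀ i, C i, Function.Injective f ∧ ∀ a b : P, f (a ⊔ b) = f a ⊔ f b) :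
    Nonempty (ℚ ↪o Order.Ideal P) ↔
      (Nonempty (ℚ ↪o P) ∨
        ∃ S : Set P, ∃ hS : ∀ a ∈ S, ∀ b ∈ S, a ⊔ b ∈ S,
          ∃ (C₁ C₂ : Type u) (i₁ : LinearOrder C₁) (i₂ : LinearOrder C₂),
            letI := i₁; letI := i₂;
            ∃ g : S → C₁ × C₂,
              Function.Injective g ∧
              (∀ (a : P) (ha : a ∈ S) (b : P) (hb : b ∈ S),
                g ⟨a ⊔ b, hS a ha b hb⟩ = g ⟨a, ha⟩ ⊔ g ⟨b, hb⟩) ∧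
              Nonempty ((Prod.fst '' Set.range g : Set C₁) ≃o ℕ) ∧
              Nonempty (ℚ ↪o (Prod.snd '' Set.range g : Set C₂)) ∧
              (∀ c : C₁, {p : C₁ × C₂ | p ∈ Set.range g ∧ p.1 = c}.Finite)) := by
  constructor
  · rintro ⟨φ⟩
    obtain ⟨n, C, inst, f, hf, hsup⟩ := hdim
    let := inst
    obtain ⟨A, J, j₀, hj₀, hA, hB⟩ := exists_rat_chain_of_ideals hf hsup φ
    let e : ℕ ≃ ℚ := (Denumerable.eqv ℚ).symm
    refine (nonempty_rat_embedding_or_exists_sequence hf hsup A J e hA hB hj₀).imp id ?_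
    rintro ⟨i₀, hi₀A, y, hi₀, hyA, hyB⟩
    exact exists_joinSubsemilattice_of_sequence hf hsup A e y hyA hyB hi₀A hi₀ hj₀
  · rintro (⟨⟨φ⟩⟩ | ⟨S, hS, C₁, C₂, i₁, i₂, g, -, hg, -, h, -⟩)
    · exact ⟨φ.trans (OrderEmbedding.ofMapLEIff Order.Ideal.principal
        fun _ _ => Order.Ideal.principal_le_iff.trans Order.Ideal.mem_principal)⟩
    · exact nonempty_rat_embedding_ideal_of_snd S hS g hg h
end
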